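/- arXiv:2507.01596 — 2 statements merged into one kernel-verified Lean document; each statement's English description precedes it below -/
import Mathlib

section
/- The edge-inducibility constant λ_{4,3} equals 1/2; that is, the maximum over n-vertex graphs G of the proportion of 4-element vertex subsets inducing exactly 3 edges tends to 1/2 as n → ∞. -/
open Finset
open scoped Classical

/-- Number of edges of `G` inside the vertex subset `S`. -/
noncomputable def edgeCount {n : ℕ} (G : SimpleGraph (Fin n)) (S : Finset (Fin n)) : ℕ :=
  (Finset.univ.filter (fun p : Fin n × Fin n =>
    p.1 ∈ S ∧ p.2 ∈ S ∧ p.1 < p.2 ∧ G.Adj p.1 p.2)).card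

/-- `Λ_{κ,ℓ}(G)`: number of `κ`-subsets of vertices inducing exactly `ℓ` edges. -/
noncomputable def numKL (κ ℓ : ℕ) {n : ℕ} (G : SimpleGraph (Fin n)) : ℕ :=
  ((Finset.powersetCard κ Finset.univ).filter (fun S => edgeCount G S = ℓ)).card

/-- `λ_{κ,ℓ}(G) = Λ_{κ,ℓ}(G) / C(n,κ)`. -/
noncomputable def lamKL (κ ℓ : ℕ) {n : ℕ} (G : SimpleGraph (Fin n)) : ℝ :=
  (numKL κ ℓ G : ℝ) / (n.choose κ : ℝ)

/-- `λ_{κ,ℓ}(n)`: the maximum of `λ_{κ,ℓ}(G)` over all graphs on `n` vertices. -/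
noncomputable def lamKLmax (κ ℓ n : ℕ) : ℝ :=
  ⨆ G : SimpleGraph (Fin n), lamKL κ ℓ G

/-- Edit distance between two graphs on `Fin n`: the minimum over bijections of the number
of vertex pairs whose adjacency must be changed in `G` to obtain a graph isomorphic to `H`. -/
noncomputable def editDist {n : ℕ} (G H : SimpleGraph (Fin n)) : ℕ :=
  ⨅ σ : Equiv.Perm (Fin n),
    (Finset.univ.filter (fun p : Fin n × Fin n =>
      p.1 < p.2 ∧ ¬ (G.Adj p.1 p.2 ↔ H.Adj (σ p.1) (σ p.2)))).card

/-- Edit distance of `G` to the family of `n`-vertex graphs satisfying `P`. -/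
noncomputable def distToFam {n : ℕ} (G : SimpleGraph (Fin n))
    (P : SimpleGraph (Fin n) → Prop) : ℕ :=
  ⨅ H : {H : SimpleGraph (Fin n) // P H}, editDist G H.1

/-- Coefficient functions of the squares. -/
def flagF : Bool → Bool → Bool → Bool → Bool → ℤ
  | false, false, false, false, false => -2
  | false, false, false, true, false => -1
  | false, false, true, false, false => -1
  | false, true, false, false, false => -1
  | false, true, true, true, false => 1
  | true, false, false, false, false => -1
  | true, false, true, true, false => 1
  | true, true, false, true, false => 1
  | true, true, true, false, false => 1
  | true, true, true, true, false => 2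
  | _, _, _, _, _ => 0

def flagG : Bool → Bool → Bool → Bool → Bool → ℤ
  | false, false, false, true, false => 154
  | false, false, false, true, true => 316
  | false, false, true, false, false => -154
  | false, false, true, false, true => -316
  | false, true, false, false, false => 154
  | false, true, false, false, true => 316
  | false, true, true, true, false => -468
  | false, true, true, true, true => -102
  | true, false, false, false, false => -154
  | true, false, false, false, true => -316
  | true, false, true, true, false => 468
  | true, false, true, true, true => 102
  | true, true, false, true, false => -468
  | true, true, false, true, true => -102
  | true, true, true, false, false => 468
  | true, true, true, false, true => 102
  | _, _, _, _, _ => 0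

def flagH : Bool → Bool → Bool → Bool → Bool → ℤ
  | false, false, false, true, false => 82
  | false, false, false, true, true => -589
  | false, false, true, false, false => -82
  | false, false, true, false, true => 589
  | false, true, false, false, false => 82
  | false, true, false, false, true => -589
  | false, true, false, true, true => -1144
  | false, true, true, true, false => -390
  | false, true, true, true, true => -391
  | true, false, false, false, false => -82
  | true, false, false, false, true => 589
  | true, false, true, false, true => 1144
  | true, false, true, true, false => 390
  | true, false, true, true, true => 391
  | true, true, false, true, false => -390
  | true, true, false, true, true => -391
  | true, true, true, false, false => 390
  | true, true, true, false, true => 391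
  | _, _, _, _, _ => 0

def signB : Bool → ℤ
  | true => 1
  | false => -1

def indB : Bool → Bool → Bool → Bool → Bool → Bool → ℤ
  | p, q, r, s, t, u => bif (p.toNat + q.toNat + r.toNat + s.toNat + t.toNat + u.toNat).beq 3 then 1 else 0

def beqB : Bool → Bool → Bool
  | true, b => b
  | false, true => false
  | false, false => true

/-- A coefficient function, read off relative to the pair `t`. -/
def rel (f : Bool → Bool → Bool → Bool → Bool → ℤ) (t p q r s w : Bool) : ℤ :=
  f (beqB t p) (beqB t q) (beqB t r) (beqB t s) (beqB t w)

/-- The part of the integrand coming from the squares, on vertices `u v a b c d`. -/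
def sqB (uv ua va ub vb ab uc vc ud vd cd : Bool) : ℤ :=
  163592 * (1 - signB ab * signB cd
      - rel flagF uv ua va ub vb ab * rel flagF uv uc vc ud vd cd)
    - rel flagG uv ua va ub vb ab * rel flagG uv uc vc ud vd cd
    - rel flagH uv ua va ub vb ab * rel flagH uv uc vc ud vd cd

def sqN (uv ua va ub vb ab uc vc ud vd cd : Bool) : ℕ :=
  (sqB uv ua va ub vb ab uc vc ud vd cd + 2000000).toNat

def indN (p q r s t u : Bool) : ℕ :=
  bif (p.toNat + q.toNat + r.toNat + s.toNat + t.toNat + u.toNat).beq 3 then 0 else 327184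

def termN (uv ua va ub vb ab uc vc ud vd cd ac ad bc bd : Bool) : ℕ :=
  Nat.add (sqN uv ua va ub vb ab uc vc ud vd cd) (indN ab ac ad bc bd cd)

/-- The integrand summed over relabellings. -/
def totN (e01 e02 e03 e04 e05 e12 e13 e14 e15 e23 e24 e25 e34 e35 e45 : Bool) : ℕ :=
  Nat.add (termN e01 e02 e12 e03 e13 e23 e04 e14 e05 e15 e45 e24 e25 e34 e35) <|
  Nat.add (termN e01 e02 e12 e04 e14 e24 e03 e13 e05 e15 e35 e23 e25 e34 e45) <|
  Nat.add (termN e01 e02 e12 e05 e15 e25 e03 e13 e04 e14 e34 e23 e24 e35 e45) <|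
  Nat.add (termN e02 e01 e12 e03 e23 e13 e04 e24 e05 e25 e45 e14 e15 e34 e35) <|
  Nat.add (termN e02 e01 e12 e04 e24 e14 e03 e23 e05 e25 e35 e13 e15 e34 e45) <|
  Nat.add (termN e02 e01 e12 e05 e25 e15 e03 e23 e04 e24 e34 e13 e14 e35 e45) <|
  Nat.add (termN e03 e01 e13 e02 e23 e12 e04 e34 e05 e35 e45 e14 e15 e24 e25) <|
  Nat.add (termN e03 e01 e13 e04 e34 e14 e02 e23 e05 e35 e25 e12 e15 e24 e45) <|
  Nat.add (termN e03 e01 e13 e05 e35 e15 e02 e23 e04 e34 e24 e12 e14 e25 e45) <|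
  Nat.add (termN e04 e01 e14 e02 e24 e12 e03 e34 e05 e45 e35 e13 e15 e23 e25) <|
  Nat.add (termN e04 e01 e14 e03 e34 e13 e02 e24 e05 e45 e25 e12 e15 e23 e35) <|
  Nat.add (termN e04 e01 e14 e05 e45 e15 e02 e24 e03 e34 e23 e12 e13 e25 e35) <|
  Nat.add (termN e05 e01 e15 e02 e25 e12 e03 e35 e04 e45 e34 e13 e14 e23 e24) <|
  Nat.add (termN e05 e01 e15 e03 e35 e13 e02 e25 e04 e45 e24 e12 e14 e23 e34) <|
  Nat.add (termN e05 e01 e15 e04 e45 e14 e02 e25 e03 e35 e23 e12 e13 e24 e34) <|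
  Nat.add (termN e12 e01 e02 e13 e23 e03 e14 e24 e15 e25 e45 e04 e05 e34 e35) <|
  Nat.add (termN e12 e01 e02 e14 e24 e04 e13 e23 e15 e25 e35 e03 e05 e34 e45) <|
  Nat.add (termN e12 e01 e02 e15 e25 e05 e13 e23 e14 e24 e34 e03 e04 e35 e45) <|
  Nat.add (termN e13 e01 e03 e12 e23 e02 e14 e34 e15 e35 e45 e04 e05 e24 e25) <|
  Nat.add (termN e13 e01 e03 e14 e34 e04 e12 e23 e15 e35 e25 e02 e05 e24 e45) <|
  Nat.add (termN e13 e01 e03 e15 e35 e05 e12 e23 e14 e34 e24 e02 e04 e25 e45) <|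
  Nat.add (termN e14 e01 e04 e12 e24 e02 e13 e34 e15 e45 e35 e03 e05 e23 e25) <|
  Nat.add (termN e14 e01 e04 e13 e34 e03 e12 e24 e15 e45 e25 e02 e05 e23 e35) <|
  Nat.add (termN e14 e01 e04 e15 e45 e05 e12 e24 e13 e34 e23 e02 e03 e25 e35) <|
  Nat.add (termN e15 e01 e05 e12 e25 e02 e13 e35 e14 e45 e34 e03 e04 e23 e24) <|
  Nat.add (termN e15 e01 e05 e13 e35 e03 e12 e25 e14 e45 e24 e02 e04 e23 e34) <|
  Nat.add (termN e15 e01 e05 e14 e45 e04 e12 e25 e13 e35 e23 e02 e03 e24 e34) <|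
  Nat.add (termN e23 e02 e03 e12 e13 e01 e24 e34 e25 e35 e45 e04 e05 e14 e15) <|
  Nat.add (termN e23 e02 e03 e24 e34 e04 e12 e13 e25 e35 e15 e01 e05 e14 e45) <|
  Nat.add (termN e23 e02 e03 e25 e35 e05 e12 e13 e24 e34 e14 e01 e04 e15 e45) <|
  Nat.add (termN e24 e02 e04 e12 e14 e01 e23 e34 e25 e45 e35 e03 e05 e13 e15) <|
  Nat.add (termN e24 e02 e04 e23 e34 e03 e12 e14 e25 e45 e15 e01 e05 e13 e35) <|
  Nat.add (termN e24 e02 e04 e25 e45 e05 e12 e14 e23 e34 e13 e01 e03 e15 e35) <|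
  Nat.add (termN e25 e02 e05 e12 e15 e01 e23 e35 e24 e45 e34 e03 e04 e13 e14) <|
  Nat.add (termN e25 e02 e05 e23 e35 e03 e12 e15 e24 e45 e14 e01 e04 e13 e34) <|
  Nat.add (termN e25 e02 e05 e24 e45 e04 e12 e15 e23 e35 e13 e01 e03 e14 e34) <|
  Nat.add (termN e34 e03 e04 e13 e14 e01 e23 e24 e35 e45 e25 e02 e05 e12 e15) <|
  Nat.add (termN e34 e03 e04 e23 e24 e02 e13 e14 e35 e45 e15 e01 e05 e12 e25) <|
  Nat.add (termN e34 e03 e04 e35 e45 e05 e13 e14 e23 e24 e12 e01 e02 e15 e25) <|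
  Nat.add (termN e35 e03 e05 e13 e15 e01 e23 e25 e34 e45 e24 e02 e04 e12 e14) <|
  Nat.add (termN e35 e03 e05 e23 e25 e02 e13 e15 e34 e45 e14 e01 e04 e12 e24) <|
  Nat.add (termN e35 e03 e05 e34 e45 e04 e13 e15 e23 e25 e12 e01 e02 e14 e24) <|
  Nat.add (termN e45 e04 e05 e14 e15 e01 e24 e25 e34 e35 e23 e02 e03 e12 e13) <|
  Nat.add (termN e45 e04 e05 e24 e25 e02 e14 e15 e34 e35 e13 e01 e03 e12 e23) <|
  termN e45 e04 e05 e34 e35 e03 e14 e15 e24 e25 e12 e01 e02 e13 e23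

def allB (f : Bool → Bool) : Bool := (f false).and (f true)

theorem allB_spec {f : Bool → Bool} (h : allB f = true) (b : Bool) : f b = true := by
  unfold allB at h
  cases b <;> simp_all

def nonnegB : ℤ → Bool
  | Int.ofNat _ => true
  | Int.negSucc _ => false

theorem totN_check : (allB fun e01 => allB fun e02 => allB fun e03 => allB fun e04 => allB fun e05 => allB fun e12 => allB fun e13 => allB fun e14 => allB fun e15 => allB fun e23 => allB fun e24 => allB fun e25 => allB fun e34 => allB fun e35 => allB fun e45 =>
    Nat.ble 104723280 (totN e01 e02 e03 e04 e05 e12 e13 e14 e15 e23 e24 e25 e34 e35 e45)) = true := by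
  decide +kernel

theorem totN_ge (e01 e02 e03 e04 e05 e12 e13 e14 e15 e23 e24 e25 e34 e35 e45 : Bool) : 104723280 ≤ totN e01 e02 e03 e04 e05 e12 e13 e14 e15 e23 e24 e25 e34 e35 e45 := by
  have h := totN_check
  replace h := allB_spec h e01
  replace h := allB_spec h e02
  replace h := allB_spec h e03
  replace h := allB_spec h e04
  replace h := allB_spec h e05
  replace h := allB_spec h e12
  replace h := allB_spec h e13
  replace h := allB_spec h e14
  replace h := allB_spec h e15
  replace h := allB_spec h e23
  replace h := allB_spec h e24
  replace h := allB_spec h e25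
  replace h := allB_spec h e34
  replace h := allB_spec h e35
  replace h := allB_spec h e45
  exact Nat.le_of_ble_eq_true h

theorem sqB_check : (allB fun uv => allB fun ua => allB fun va => allB fun ub => allB fun vb => allB fun ab => allB fun uc => allB fun vc => allB fun ud => allB fun vd => allB fun cd =>
    nonnegB (sqB uv ua va ub vb ab uc vc ud vd cd + 2000000)) = true := by
  decide +kernel

theorem nonneg_of_nonnegB {z : ℤ} (h : nonnegB z = true) : 0 ≤ z := by
  cases z with
  | ofNat m => exact Int.natCast_nonneg m
  | negSucc m => simp [nonnegB] at h

theorem sqB_ge (uv ua va ub vb ab uc vc ud vd cd : Bool) : 0 ≤ sqB uv ua va ub vb ab uc vc ud vd cd + 2000000 := by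
  have h := sqB_check
  replace h := allB_spec h uv
  replace h := allB_spec h ua
  replace h := allB_spec h va
  replace h := allB_spec h ub
  replace h := allB_spec h vb
  replace h := allB_spec h ab
  replace h := allB_spec h uc
  replace h := allB_spec h vc
  replace h := allB_spec h ud
  replace h := allB_spec h vd
  replace h := allB_spec h cd
  exact nonneg_of_nonnegB h

/-- The integrand on six vertices. -/
def termB (uv ua va ub vb ab uc vc ud vd cd ac ad bc bd : Bool) : ℤ :=
  sqB uv ua va ub vb ab uc vc ud vd cd - 327184 * indB ab ac ad bc bd cd

theorem termN_cast (uv ua va ub vb ab uc vc ud vd cd ac ad bc bd : Bool) :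
    ((termN uv ua va ub vb ab uc vc ud vd cd ac ad bc bd : ℕ) : ℤ)
      = termB uv ua va ub vb ab uc vc ud vd cd ac ad bc bd + 2327184 := by
  have h1 : ((sqN uv ua va ub vb ab uc vc ud vd cd : ℕ) : ℤ)
      = sqB uv ua va ub vb ab uc vc ud vd cd + 2000000 :=
    Int.toNat_of_nonneg (sqB_ge _ _ _ _ _ _ _ _ _ _ _)
  have h2 : ∀ p q r s t u : Bool,
      ((indN p q r s t u : ℕ) : ℤ) = 327184 - 327184 * indB p q r s t u := by decide
  have h3 : termN uv ua va ub vb ab uc vc ud vd cd ac ad bc bd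
      = sqN uv ua va ub vb ab uc vc ud vd cd + indN ab ac ad bc bd cd := rfl
  rw [h3, Nat.cast_add, h1, h2, termB]
  ring

theorem cast_nat_add (a b : ℕ) : ((Nat.add a b : ℕ) : ℤ) = a + b := Nat.cast_add a b

set_option maxHeartbeats 2000000 in
theorem totB_nonneg (e01 e02 e03 e04 e05 e12 e13 e14 e15 e23 e24 e25 e34 e35 e45 : Bool) : 0 ≤
    termB e01 e02 e12 e03 e13 e23 e04 e14 e05 e15 e45 e24 e25 e34 e35 +
    termB e01 e02 e12 e04 e14 e24 e03 e13 e05 e15 e35 e23 e25 e34 e45 +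
    termB e01 e02 e12 e05 e15 e25 e03 e13 e04 e14 e34 e23 e24 e35 e45 +
    termB e02 e01 e12 e03 e23 e13 e04 e24 e05 e25 e45 e14 e15 e34 e35 +
    termB e02 e01 e12 e04 e24 e14 e03 e23 e05 e25 e35 e13 e15 e34 e45 +
    termB e02 e01 e12 e05 e25 e15 e03 e23 e04 e24 e34 e13 e14 e35 e45 +
    termB e03 e01 e13 e02 e23 e12 e04 e34 e05 e35 e45 e14 e15 e24 e25 +
    termB e03 e01 e13 e04 e34 e14 e02 e23 e05 e35 e25 e12 e15 e24 e45 +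
    termB e03 e01 e13 e05 e35 e15 e02 e23 e04 e34 e24 e12 e14 e25 e45 +
    termB e04 e01 e14 e02 e24 e12 e03 e34 e05 e45 e35 e13 e15 e23 e25 +
    termB e04 e01 e14 e03 e34 e13 e02 e24 e05 e45 e25 e12 e15 e23 e35 +
    termB e04 e01 e14 e05 e45 e15 e02 e24 e03 e34 e23 e12 e13 e25 e35 +
    termB e05 e01 e15 e02 e25 e12 e03 e35 e04 e45 e34 e13 e14 e23 e24 +
    termB e05 e01 e15 e03 e35 e13 e02 e25 e04 e45 e24 e12 e14 e23 e34 +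
    termB e05 e01 e15 e04 e45 e14 e02 e25 e03 e35 e23 e12 e13 e24 e34 +
    termB e12 e01 e02 e13 e23 e03 e14 e24 e15 e25 e45 e04 e05 e34 e35 +
    termB e12 e01 e02 e14 e24 e04 e13 e23 e15 e25 e35 e03 e05 e34 e45 +
    termB e12 e01 e02 e15 e25 e05 e13 e23 e14 e24 e34 e03 e04 e35 e45 +
    termB e13 e01 e03 e12 e23 e02 e14 e34 e15 e35 e45 e04 e05 e24 e25 +
    termB e13 e01 e03 e14 e34 e04 e12 e23 e15 e35 e25 e02 e05 e24 e45 +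
    termB e13 e01 e03 e15 e35 e05 e12 e23 e14 e34 e24 e02 e04 e25 e45 +
    termB e14 e01 e04 e12 e24 e02 e13 e34 e15 e45 e35 e03 e05 e23 e25 +
    termB e14 e01 e04 e13 e34 e03 e12 e24 e15 e45 e25 e02 e05 e23 e35 +
    termB e14 e01 e04 e15 e45 e05 e12 e24 e13 e34 e23 e02 e03 e25 e35 +
    termB e15 e01 e05 e12 e25 e02 e13 e35 e14 e45 e34 e03 e04 e23 e24 +
    termB e15 e01 e05 e13 e35 e03 e12 e25 e14 e45 e24 e02 e04 e23 e34 +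
    termB e15 e01 e05 e14 e45 e04 e12 e25 e13 e35 e23 e02 e03 e24 e34 +
    termB e23 e02 e03 e12 e13 e01 e24 e34 e25 e35 e45 e04 e05 e14 e15 +
    termB e23 e02 e03 e24 e34 e04 e12 e13 e25 e35 e15 e01 e05 e14 e45 +
    termB e23 e02 e03 e25 e35 e05 e12 e13 e24 e34 e14 e01 e04 e15 e45 +
    termB e24 e02 e04 e12 e14 e01 e23 e34 e25 e45 e35 e03 e05 e13 e15 +
    termB e24 e02 e04 e23 e34 e03 e12 e14 e25 e45 e15 e01 e05 e13 e35 +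
    termB e24 e02 e04 e25 e45 e05 e12 e14 e23 e34 e13 e01 e03 e15 e35 +
    termB e25 e02 e05 e12 e15 e01 e23 e35 e24 e45 e34 e03 e04 e13 e14 +
    termB e25 e02 e05 e23 e35 e03 e12 e15 e24 e45 e14 e01 e04 e13 e34 +
    termB e25 e02 e05 e24 e45 e04 e12 e15 e23 e35 e13 e01 e03 e14 e34 +
    termB e34 e03 e04 e13 e14 e01 e23 e24 e35 e45 e25 e02 e05 e12 e15 +
    termB e34 e03 e04 e23 e24 e02 e13 e14 e35 e45 e15 e01 e05 e12 e25 +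
    termB e34 e03 e04 e35 e45 e05 e13 e14 e23 e24 e12 e01 e02 e15 e25 +
    termB e35 e03 e05 e13 e15 e01 e23 e25 e34 e45 e24 e02 e04 e12 e14 +
    termB e35 e03 e05 e23 e25 e02 e13 e15 e34 e45 e14 e01 e04 e12 e24 +
    termB e35 e03 e05 e34 e45 e04 e13 e15 e23 e25 e12 e01 e02 e14 e24 +
    termB e45 e04 e05 e14 e15 e01 e24 e25 e34 e35 e23 e02 e03 e12 e13 +
    termB e45 e04 e05 e24 e25 e02 e14 e15 e34 e35 e13 e01 e03 e12 e23 +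
    termB e45 e04 e05 e34 e35 e03 e14 e15 e24 e25 e12 e01 e02 e13 e23 := by
  have h := totN_ge e01 e02 e03 e04 e05 e12 e13 e14 e15 e23 e24 e25 e34 e35 e45
  unfold totN at h
  rw [← Int.ofNat_le] at h
  simp only [cast_nat_add] at h
  simp only [termN_cast] at h
  push_cast at h
  linarith

section Sums

variable {V : Type*} [Fintype V]

/-- The integrand for a symmetric Boolean relation `e`. -/
def termE (e : V → V → Bool) (u v a b c d : V) : ℤ :=
  termB (e u v) (e u a) (e v a) (e u b) (e v b) (e a b) (e u c) (e v c) (e u d) (e v d) (e c d)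
    (e a c) (e a d) (e b c) (e b d)

theorem sum_tuple_succ {k : ℕ} (F : (Fin (k + 1) → V) → ℤ) :
    ∑ τ, F τ = ∑ u : V, ∑ τ : Fin k → V, F (Fin.cons u τ : Fin (k + 1) → V) := by
  classical
  rw [← Fintype.sum_prod_type']
  exact (Fintype.sum_equiv (Fin.consEquiv (fun _ : Fin (k + 1) => V)) _ _ (fun x => rfl)).symm

theorem sum_tuple_six (F : V → V → V → V → V → V → ℤ) :
    ∑ τ : Fin 6 → V, F (τ 0) (τ 1) (τ 2) (τ 3) (τ 4) (τ 5)
      = ∑ u, ∑ v, ∑ a, ∑ b, ∑ c, ∑ d, F u v a b c d := by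
  simp only [sum_tuple_succ]
  simp only [Finset.univ_unique, Finset.sum_singleton]
  rfl

theorem sum_relabel (F : V → V → V → V → V → V → ℤ) (i j k l m o : Fin 6)
    (h : Function.Injective ![i, j, k, l, m, o]) :
    ∑ τ : Fin 6 → V, F (τ i) (τ j) (τ k) (τ l) (τ m) (τ o)
      = ∑ τ : Fin 6 → V, F (τ 0) (τ 1) (τ 2) (τ 3) (τ 4) (τ 5) := by
  have hb : Function.Bijective ![i, j, k, l, m, o] := Finite.injective_iff_bijective.mp h
  exact Fintype.sum_equiv ((Equiv.ofBijective _ hb).symm.arrowCongr (Equiv.refl V)) _ _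
    (fun τ => rfl)

theorem sum_sq_form (X : V → V → ℤ) :
    ∑ a, ∑ b, ∑ c, ∑ d, X a b * X c d = (∑ a, ∑ b, X a b) ^ 2 := by
  simp only [sq, ← Finset.sum_mul, ← Finset.mul_sum]

theorem sum_termE (e : V → V → Bool) :
    ∑ u, ∑ v, ∑ a, ∑ b, ∑ c, ∑ d, termE e u v a b c d
      ≤ 163592 * (Fintype.card V : ℤ) ^ 6 - 327184 * ((Fintype.card V : ℤ) ^ 2 *
        ∑ a, ∑ b, ∑ c, ∑ d, indB (e a b) (e a c) (e a d) (e b c) (e b d) (e c d)) := by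
  have key : ∀ u v : V, ∑ a, ∑ b, ∑ c, ∑ d, termE e u v a b c d
      = 163592 * (Fintype.card V : ℤ) ^ 4
        - 327184 * ∑ a, ∑ b, ∑ c, ∑ d, indB (e a b) (e a c) (e a d) (e b c) (e b d) (e c d)
        - 163592 * (∑ a, ∑ b, signB (e a b)) ^ 2
        - 163592 * (∑ a, ∑ b, rel flagF (e u v) (e u a) (e v a) (e u b) (e v b) (e a b)) ^ 2
        - (∑ a, ∑ b, rel flagG (e u v) (e u a) (e v a) (e u b) (e v b) (e a b)) ^ 2
        - (∑ a, ∑ b, rel flagH (e u v) (e u a) (e v a) (e u b) (e v b) (e a b)) ^ 2 := by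
    intro u v
    simp only [← sum_sq_form, termE, termB, sqB, mul_sub, mul_one, Finset.sum_sub_distrib,
      Finset.sum_const, Finset.card_univ, nsmul_eq_mul, ← Finset.mul_sum]
    ring
  have key2 : ∀ u v : V, ∑ a, ∑ b, ∑ c, ∑ d, termE e u v a b c d
      ≤ 163592 * (Fintype.card V : ℤ) ^ 4
        - 327184 * ∑ a, ∑ b, ∑ c, ∑ d, indB (e a b) (e a c) (e a d) (e b c) (e b d) (e c d) := by
    intro u v
    rw [key u v]
    nlinarith [sq_nonneg (∑ a, ∑ b, signB (e a b)),
      sq_nonneg (∑ a, ∑ b, rel flagF (e u v) (e u a) (e v a) (e u b) (e v b) (e a b)),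
      sq_nonneg (∑ a, ∑ b, rel flagG (e u v) (e u a) (e v a) (e u b) (e v b) (e a b)),
      sq_nonneg (∑ a, ∑ b, rel flagH (e u v) (e u a) (e v a) (e u b) (e v b) (e a b))]
  refine (Finset.sum_le_sum fun u _ => Finset.sum_le_sum fun v _ => key2 u v).trans ?_
  simp only [Finset.sum_const, Finset.card_univ, nsmul_eq_mul]
  apply le_of_eq
  ring

set_option maxHeartbeats 2000000 in
theorem sum_termE_nonneg (e : V → V → Bool) (he : ∀ u v, e u v = e v u) :
    0 ≤ ∑ u, ∑ v, ∑ a, ∑ b, ∑ c, ∑ d, termE e u v a b c d := by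
  rw [← sum_tuple_six]
  have hpt : ∀ τ : Fin 6 → V, 0 ≤
      termE e (τ 0) (τ 1) (τ 2) (τ 3) (τ 4) (τ 5) +
      termE e (τ 0) (τ 1) (τ 2) (τ 4) (τ 3) (τ 5) +
      termE e (τ 0) (τ 1) (τ 2) (τ 5) (τ 3) (τ 4) +
      termE e (τ 0) (τ 2) (τ 1) (τ 3) (τ 4) (τ 5) +
      termE e (τ 0) (τ 2) (τ 1) (τ 4) (τ 3) (τ 5) +
      termE e (τ 0) (τ 2) (τ 1) (τ 5) (τ 3) (τ 4) +
      termE e (τ 0) (τ 3) (τ 1) (τ 2) (τ 4) (τ 5) +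
      termE e (τ 0) (τ 3) (τ 1) (τ 4) (τ 2) (τ 5) +
      termE e (τ 0) (τ 3) (τ 1) (τ 5) (τ 2) (τ 4) +
      termE e (τ 0) (τ 4) (τ 1) (τ 2) (τ 3) (τ 5) +
      termE e (τ 0) (τ 4) (τ 1) (τ 3) (τ 2) (τ 5) +
      termE e (τ 0) (τ 4) (τ 1) (τ 5) (τ 2) (τ 3) +
      termE e (τ 0) (τ 5) (τ 1) (τ 2) (τ 3) (τ 4) +
      termE e (τ 0) (τ 5) (τ 1) (τ 3) (τ 2) (τ 4) +
      termE e (τ 0) (τ 5) (τ 1) (τ 4) (τ 2) (τ 3) +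
      termE e (τ 1) (τ 2) (τ 0) (τ 3) (τ 4) (τ 5) +
      termE e (τ 1) (τ 2) (τ 0) (τ 4) (τ 3) (τ 5) +
      termE e (τ 1) (τ 2) (τ 0) (τ 5) (τ 3) (τ 4) +
      termE e (τ 1) (τ 3) (τ 0) (τ 2) (τ 4) (τ 5) +
      termE e (τ 1) (τ 3) (τ 0) (τ 4) (τ 2) (τ 5) +
      termE e (τ 1) (τ 3) (τ 0) (τ 5) (τ 2) (τ 4) +
      termE e (τ 1) (τ 4) (τ 0) (τ 2) (τ 3) (τ 5) +
      termE e (τ 1) (τ 4) (τ 0) (τ 3) (τ 2) (τ 5) +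
      termE e (τ 1) (τ 4) (τ 0) (τ 5) (τ 2) (τ 3) +
      termE e (τ 1) (τ 5) (τ 0) (τ 2) (τ 3) (τ 4) +
      termE e (τ 1) (τ 5) (τ 0) (τ 3) (τ 2) (τ 4) +
      termE e (τ 1) (τ 5) (τ 0) (τ 4) (τ 2) (τ 3) +
      termE e (τ 2) (τ 3) (τ 0) (τ 1) (τ 4) (τ 5) +
      termE e (τ 2) (τ 3) (τ 0) (τ 4) (τ 1) (τ 5) +
      termE e (τ 2) (τ 3) (τ 0) (τ 5) (τ 1) (τ 4) +
      termE e (τ 2) (τ 4) (τ 0) (τ 1) (τ 3) (τ 5) +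
      termE e (τ 2) (τ 4) (τ 0) (τ 3) (τ 1) (τ 5) +
      termE e (τ 2) (τ 4) (τ 0) (τ 5) (τ 1) (τ 3) +
      termE e (τ 2) (τ 5) (τ 0) (τ 1) (τ 3) (τ 4) +
      termE e (τ 2) (τ 5) (τ 0) (τ 3) (τ 1) (τ 4) +
      termE e (τ 2) (τ 5) (τ 0) (τ 4) (τ 1) (τ 3) +
      termE e (τ 3) (τ 4) (τ 0) (τ 1) (τ 2) (τ 5) +
      termE e (τ 3) (τ 4) (τ 0) (τ 2) (τ 1) (τ 5) +
      termE e (τ 3) (τ 4) (τ 0) (τ 5) (τ 1) (τ 2) +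
      termE e (τ 3) (τ 5) (τ 0) (τ 1) (τ 2) (τ 4) +
      termE e (τ 3) (τ 5) (τ 0) (τ 2) (τ 1) (τ 4) +
      termE e (τ 3) (τ 5) (τ 0) (τ 4) (τ 1) (τ 2) +
      termE e (τ 4) (τ 5) (τ 0) (τ 1) (τ 2) (τ 3) +
      termE e (τ 4) (τ 5) (τ 0) (τ 2) (τ 1) (τ 3) +
      termE e (τ 4) (τ 5) (τ 0) (τ 3) (τ 1) (τ 2) := by
    intro τ
    have h := totB_nonneg (e (τ 0) (τ 1))
      (e (τ 0) (τ 2))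
      (e (τ 0) (τ 3))
      (e (τ 0) (τ 4))
      (e (τ 0) (τ 5))
      (e (τ 1) (τ 2))
      (e (τ 1) (τ 3))
      (e (τ 1) (τ 4))
      (e (τ 1) (τ 5))
      (e (τ 2) (τ 3))
      (e (τ 2) (τ 4))
      (e (τ 2) (τ 5))
      (e (τ 3) (τ 4))
      (e (τ 3) (τ 5))
      (e (τ 4) (τ 5))
    simp only [termE]
    simp only [he (τ 1) (τ 0),
      he (τ 2) (τ 0),
      he (τ 3) (τ 0),
      he (τ 4) (τ 0),
      he (τ 5) (τ 0),
      he (τ 2) (τ 1),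
      he (τ 3) (τ 1),
      he (τ 4) (τ 1),
      he (τ 5) (τ 1),
      he (τ 3) (τ 2),
      he (τ 4) (τ 2),
      he (τ 5) (τ 2),
      he (τ 4) (τ 3),
      he (τ 5) (τ 3),
      he (τ 5) (τ 4)]
    exact h
  have hsum := Finset.sum_nonneg fun τ (_ : τ ∈ (Finset.univ : Finset (Fin 6 → V))) => hpt τ
  simp only [Finset.sum_add_distrib] at hsum
  rw [
    sum_relabel (termE e) 0 1 2 4 3 5 (by decide),
    sum_relabel (termE e) 0 1 2 5 3 4 (by decide),
    sum_relabel (termE e) 0 2 1 3 4 5 (by decide),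
    sum_relabel (termE e) 0 2 1 4 3 5 (by decide),
    sum_relabel (termE e) 0 2 1 5 3 4 (by decide),
    sum_relabel (termE e) 0 3 1 2 4 5 (by decide),
    sum_relabel (termE e) 0 3 1 4 2 5 (by decide),
    sum_relabel (termE e) 0 3 1 5 2 4 (by decide),
    sum_relabel (termE e) 0 4 1 2 3 5 (by decide),
    sum_relabel (termE e) 0 4 1 3 2 5 (by decide),
    sum_relabel (termE e) 0 4 1 5 2 3 (by decide),
    sum_relabel (termE e) 0 5 1 2 3 4 (by decide),
    sum_relabel (termE e) 0 5 1 3 2 4 (by decide),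
    sum_relabel (termE e) 0 5 1 4 2 3 (by decide),
    sum_relabel (termE e) 1 2 0 3 4 5 (by decide),
    sum_relabel (termE e) 1 2 0 4 3 5 (by decide),
    sum_relabel (termE e) 1 2 0 5 3 4 (by decide),
    sum_relabel (termE e) 1 3 0 2 4 5 (by decide),
    sum_relabel (termE e) 1 3 0 4 2 5 (by decide),
    sum_relabel (termE e) 1 3 0 5 2 4 (by decide),
    sum_relabel (termE e) 1 4 0 2 3 5 (by decide),
    sum_relabel (termE e) 1 4 0 3 2 5 (by decide),
    sum_relabel (termE e) 1 4 0 5 2 3 (by decide),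
    sum_relabel (termE e) 1 5 0 2 3 4 (by decide),
    sum_relabel (termE e) 1 5 0 3 2 4 (by decide),
    sum_relabel (termE e) 1 5 0 4 2 3 (by decide),
    sum_relabel (termE e) 2 3 0 1 4 5 (by decide),
    sum_relabel (termE e) 2 3 0 4 1 5 (by decide),
    sum_relabel (termE e) 2 3 0 5 1 4 (by decide),
    sum_relabel (termE e) 2 4 0 1 3 5 (by decide),
    sum_relabel (termE e) 2 4 0 3 1 5 (by decide),
    sum_relabel (termE e) 2 4 0 5 1 3 (by decide),
    sum_relabel (termE e) 2 5 0 1 3 4 (by decide),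
    sum_relabel (termE e) 2 5 0 3 1 4 (by decide),
    sum_relabel (termE e) 2 5 0 4 1 3 (by decide),
    sum_relabel (termE e) 3 4 0 1 2 5 (by decide),
    sum_relabel (termE e) 3 4 0 2 1 5 (by decide),
    sum_relabel (termE e) 3 4 0 5 1 2 (by decide),
    sum_relabel (termE e) 3 5 0 1 2 4 (by decide),
    sum_relabel (termE e) 3 5 0 2 1 4 (by decide),
    sum_relabel (termE e) 3 5 0 4 1 2 (by decide),
    sum_relabel (termE e) 4 5 0 1 2 3 (by decide),
    sum_relabel (termE e) 4 5 0 2 1 3 (by decide),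
    sum_relabel (termE e) 4 5 0 3 1 2 (by decide)] at hsum
  linarith

/-- The counting inequality: at most half of all quadruples span exactly three pairs. -/
theorem quad_bound [Nonempty V] (e : V → V → Bool) (he : ∀ u v, e u v = e v u) :
    2 * ∑ a, ∑ b, ∑ c, ∑ d, indB (e a b) (e a c) (e a d) (e b c) (e b d) (e c d)
      ≤ (Fintype.card V : ℤ) ^ 4 := by
  have h := (sum_termE_nonneg e he).trans (sum_termE e)
  have hpos : (0 : ℤ) < (Fintype.card V : ℤ) ^ 2 := by
    have : (0 : ℤ) < (Fintype.card V : ℤ) := by exact_mod_cast Fintype.card_pos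
    positivity
  refine le_of_mul_le_mul_left ?_ hpos
  nlinarith

end Sums

section Upper

/-- Twice the number of edges inside `S` is the number of ordered adjacent pairs. -/
theorem two_mul_edgeCount {n : ℕ} (G : SimpleGraph (Fin n)) (S : Finset (Fin n)) :
    2 * edgeCount G S = ∑ a ∈ S, ∑ b ∈ S, (decide (G.Adj a b)).toNat := by
  have h1 : ∑ a ∈ S, ∑ b ∈ S, (decide (G.Adj a b)).toNat
      = ((S ×ˢ S).filter (fun p : Fin n × Fin n => G.Adj p.1 p.2)).card := by
    rw [Finset.card_filter, Finset.sum_product]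
    refine Finset.sum_congr rfl fun a _ => Finset.sum_congr rfl fun b _ => ?_
    by_cases h : G.Adj a b <;> simp [h]
  have h2 : ((S ×ˢ S).filter (fun p : Fin n × Fin n => G.Adj p.1 p.2))
      = (Finset.univ.filter (fun p : Fin n × Fin n =>
          p.1 ∈ S ∧ p.2 ∈ S ∧ p.1 < p.2 ∧ G.Adj p.1 p.2))
        ∪ (Finset.univ.filter (fun p : Fin n × Fin n =>
          p.1 ∈ S ∧ p.2 ∈ S ∧ p.1 < p.2 ∧ G.Adj p.1 p.2)).map
            (Equiv.prodComm (Fin n) (Fin n)).toEmbedding := by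
    ext ⟨a, b⟩
    simp only [Finset.mem_filter, Finset.mem_product, Finset.mem_union, Finset.mem_univ, true_and,
      Finset.mem_map_equiv, Equiv.prodComm_symm, Equiv.prodComm_apply, Prod.swap_prod_mk]
    constructor
    · rintro ⟨⟨ha, hb⟩, hab⟩
      rcases lt_or_gt_of_ne hab.ne with h | h
      · exact Or.inl ⟨ha, hb, h, hab⟩
      · exact Or.inr ⟨hb, ha, h, hab.symm⟩
    · rintro (⟨ha, hb, _, hab⟩ | ⟨hb, ha, _, hab⟩)
      · exact ⟨⟨ha, hb⟩, hab⟩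
      · exact ⟨⟨ha, hb⟩, hab.symm⟩
  rw [h1, h2, Finset.card_union_of_disjoint, Finset.card_map, edgeCount, two_mul]
  rw [Finset.disjoint_left]
  rintro ⟨a, b⟩ h h'
  simp only [Finset.mem_filter, Finset.mem_univ, true_and,
      Finset.mem_map_equiv, Equiv.prodComm_symm, Equiv.prodComm_apply, Prod.swap_prod_mk] at h h'
  exact absurd h.2.2.1 (not_lt.mpr h'.2.2.1.le)

theorem indB_of_tuple {n : ℕ} (G : SimpleGraph (Fin n)) (τ : Fin 4 → Fin n)
    (hτ : Function.Injective τ) (h : edgeCount G (Finset.univ.image τ) = 3) :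
    indB (decide (G.Adj (τ 0) (τ 1))) (decide (G.Adj (τ 0) (τ 2))) (decide (G.Adj (τ 0) (τ 3)))
      (decide (G.Adj (τ 1) (τ 2))) (decide (G.Adj (τ 1) (τ 3)))
      (decide (G.Adj (τ 2) (τ 3))) = 1 := by
  have h2 := two_mul_edgeCount G (Finset.univ.image τ)
  rw [h, Finset.sum_image (fun a _ b _ hab => hτ hab)] at h2
  simp only [Finset.sum_image (fun a _ b _ hab => hτ hab), Fin.sum_univ_four,
    SimpleGraph.irrefl, decide_false, Bool.toNat_false,
    G.adj_comm (τ 1) (τ 0), G.adj_comm (τ 2) (τ 0), G.adj_comm (τ 3) (τ 0),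
    G.adj_comm (τ 2) (τ 1), G.adj_comm (τ 3) (τ 1), G.adj_comm (τ 3) (τ 2)] at h2
  have h3 : (decide (G.Adj (τ 0) (τ 1))).toNat + (decide (G.Adj (τ 0) (τ 2))).toNat
      + (decide (G.Adj (τ 0) (τ 3))).toNat + (decide (G.Adj (τ 1) (τ 2))).toNat
      + (decide (G.Adj (τ 1) (τ 3))).toNat + (decide (G.Adj (τ 2) (τ 3))).toNat = 3 := by
    omega
  rw [indB, h3]
  rfl

theorem indB_cases (p q r s t u : Bool) :
    indB p q r s t u = 0 ∨ indB p q r s t u = 1 := by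
  revert p q r s t u
  decide

theorem numKL_le_sum {n : ℕ} (G : SimpleGraph (Fin n)) :
    (24 * numKL 4 3 G : ℤ) ≤ ∑ τ : Fin 4 → Fin n,
      indB (decide (G.Adj (τ 0) (τ 1))) (decide (G.Adj (τ 0) (τ 2))) (decide (G.Adj (τ 0) (τ 3)))
        (decide (G.Adj (τ 1) (τ 2))) (decide (G.Adj (τ 1) (τ 3)))
        (decide (G.Adj (τ 2) (τ 3))) := by
  set 𝒮 := (Finset.powersetCard 4 (Finset.univ : Finset (Fin n))).filter
    (fun S => edgeCount G S = 3) with h𝒮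
  set 𝒯 := (Finset.univ : Finset (Fin 4 → Fin n)).filter
    (fun τ => Function.Injective τ ∧ Finset.univ.image τ ∈ 𝒮) with h𝒯
  have hfib : ∀ S ∈ 𝒮, 24 ≤ (𝒯.filter (fun τ => Finset.univ.image τ = S)).card := by
    intro S hS
    have hcard : S.card = 4 := by
      have := (Finset.mem_filter.mp hS).1
      exact (Finset.mem_powersetCard.mp this).2
    have hp : (Finset.univ : Finset (Equiv.Perm (Fin 4))).card = 24 := by
      rw [Finset.card_univ, Fintype.card_perm]; rfl
    rw [← hp]
    refine Finset.card_le_card_of_injOn (fun σ => (S.orderEmbOfFin hcard) ∘ σ) ?_ ?_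
    · intro σ _
      have hinj : Function.Injective ((S.orderEmbOfFin hcard) ∘ σ) :=
        (S.orderEmbOfFin hcard).injective.comp σ.injective
      have him : Finset.univ.image ((S.orderEmbOfFin hcard) ∘ σ) = S := by
        apply Finset.eq_of_subset_of_card_le
        · intro x hx
          obtain ⟨i, _, rfl⟩ := Finset.mem_image.mp hx
          exact Finset.orderEmbOfFin_mem S hcard _
        · rw [Finset.card_image_of_injective _ hinj, hcard]; simp
      simp only [Finset.coe_filter, Set.mem_setOf_eq, h𝒯, Finset.mem_filter, Finset.mem_univ,
        true_and]
      exact ⟨⟨hinj, by rw [him]; exact hS⟩, him⟩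
    · intro σ _ σ' _ h
      ext i
      have := congrFun h i
      exact congrArg Fin.val ((S.orderEmbOfFin hcard).injective this)
  have hc : 24 * 𝒮.card ≤ 𝒯.card := by
    rw [Finset.card_eq_sum_card_fiberwise (f := fun τ : Fin 4 → Fin n => Finset.univ.image τ)
      (s := 𝒯) (t := 𝒮) (fun τ hτ => (Finset.mem_filter.mp hτ).2.2)]
    calc 24 * 𝒮.card = ∑ S ∈ 𝒮, 24 := by rw [Finset.sum_const, smul_eq_mul, mul_comm]
      _ ≤ _ := Finset.sum_le_sum hfib
  have hN : numKL 4 3 G = 𝒮.card := rfl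
  rw [hN]
  calc (24 * (𝒮.card : ℤ)) ≤ (𝒯.card : ℤ) := by exact_mod_cast hc
    _ = ∑ τ ∈ 𝒯, (1 : ℤ) := by simp
    _ = ∑ τ ∈ 𝒯, indB (decide (G.Adj (τ 0) (τ 1))) (decide (G.Adj (τ 0) (τ 2)))
        (decide (G.Adj (τ 0) (τ 3))) (decide (G.Adj (τ 1) (τ 2))) (decide (G.Adj (τ 1) (τ 3)))
        (decide (G.Adj (τ 2) (τ 3))) := by
      refine Finset.sum_congr rfl fun τ hτ => ?_
      have h := (Finset.mem_filter.mp hτ).2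
      exact (indB_of_tuple G τ h.1 (Finset.mem_filter.mp h.2).2).symm
    _ ≤ _ := by
      refine Finset.sum_le_sum_of_subset_of_nonneg (Finset.subset_univ _) fun τ _ _ => ?_
      rcases indB_cases (decide (G.Adj (τ 0) (τ 1))) (decide (G.Adj (τ 0) (τ 2)))
        (decide (G.Adj (τ 0) (τ 3))) (decide (G.Adj (τ 1) (τ 2))) (decide (G.Adj (τ 1) (τ 3)))
        (decide (G.Adj (τ 2) (τ 3))) with h | h <;> rw [h]
      exact zero_le_one

theorem sum_tuple_four {V : Type*} [Fintype V] (F : V → V → V → V → ℤ) :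
    ∑ τ : Fin 4 → V, F (τ 0) (τ 1) (τ 2) (τ 3) = ∑ a, ∑ b, ∑ c, ∑ d, F a b c d := by
  simp only [sum_tuple_succ]
  simp only [Finset.univ_unique, Finset.sum_singleton]
  rfl

theorem numKL_le {n : ℕ} (hn : 0 < n) (G : SimpleGraph (Fin n)) :
    48 * numKL 4 3 G ≤ n ^ 4 := by
  haveI : Nonempty (Fin n) := ⟨⟨0, hn⟩⟩
  have h1 := numKL_le_sum G
  have h2 := quad_bound (fun u v => decide (G.Adj u v))
    (fun u v => by simp only [G.adj_comm u v])
  rw [sum_tuple_four (fun a b c d => indB (decide (G.Adj a b)) (decide (G.Adj a c))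
    (decide (G.Adj a d)) (decide (G.Adj b c)) (decide (G.Adj b d)) (decide (G.Adj c d)))] at h1
  rw [Fintype.card_fin] at h2
  have h3 : (48 * numKL 4 3 G : ℤ) ≤ (n : ℤ) ^ 4 := by linarith
  exact_mod_cast h3

end Upper

section Lower

/-- The complete bipartite graph between the vertices below `m` and the others. -/
def bip (n m : ℕ) : SimpleGraph (Fin n) where
  Adj a b := (a.1 < m ∧ m ≤ b.1) ∨ (b.1 < m ∧ m ≤ a.1)
  symm := ⟨fun a b h => h.symm⟩
  loopless := ⟨fun a h => by omega⟩

theorem edgeCount_bip (n m : ℕ) (S : Finset (Fin n)) :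
    edgeCount (bip n m) S
      = (S.filter (fun a => a.1 < m)).card * (S.filter (fun a => m ≤ a.1)).card := by
  rw [edgeCount, ← Finset.card_product]
  congr 1
  ext ⟨a, b⟩
  simp only [Finset.mem_filter, Finset.mem_univ, true_and, Finset.mem_product, bip, Fin.lt_def]
  constructor
  · rintro ⟨ha, hb, hab, h | h⟩
    · exact ⟨⟨ha, h.1⟩, hb, h.2⟩
    · omega
  · rintro ⟨⟨ha, h1⟩, hb, h2⟩
    exact ⟨ha, hb, by omega, Or.inl ⟨h1, h2⟩⟩

theorem numKL_bip (n m : ℕ) (hm : m ≤ n) :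
    m.choose 3 * (n - m) + (n - m).choose 3 * m ≤ numKL 4 3 (bip n m) := by
  set A := (Finset.univ : Finset (Fin n)).filter (fun a => a.1 < m) with hA
  set B := (Finset.univ : Finset (Fin n)).filter (fun a => m ≤ a.1) with hB
  have hAc : A.card = m := by
    rw [hA, Fin.card_filter_val_lt]; exact min_eq_right hm
  have hBc : B.card = n - m := by
    have h1 := Finset.card_filter_add_card_filter_not (s := (Finset.univ : Finset (Fin n)))
      (fun a => a.1 < m)
    simp only [not_lt, Finset.card_univ, Fintype.card_fin] at h1
    rw [← hA, ← hB] at h1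
    omega
  have hSA : ∀ S : Finset (Fin n), ∀ T U : Finset (Fin n), T ⊆ A → U ⊆ B → S = T ∪ U →
      S.filter (fun a => a.1 < m) = T ∧ S.filter (fun a => m ≤ a.1) = U := by
    rintro S T U hT hU rfl
    constructor
    · ext x
      simp only [Finset.mem_filter, Finset.mem_union]
      constructor
      · rintro ⟨h | h, hx⟩
        · exact h
        · have := (Finset.mem_filter.mp (hU h)).2
          omega
      · intro h
        exact ⟨Or.inl h, (Finset.mem_filter.mp (hT h)).2⟩
    · ext x
      simp only [Finset.mem_filter, Finset.mem_union]
      constructor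
      · rintro ⟨h | h, hx⟩
        · have := (Finset.mem_filter.mp (hT h)).2
          omega
        · exact h
      · intro h
        exact ⟨Or.inr h, (Finset.mem_filter.mp (hU h)).2⟩
  have hdisj : ∀ T U : Finset (Fin n), T ⊆ A → U ⊆ B → Disjoint T U := by
    intro T U hT hU
    rw [Finset.disjoint_left]
    intro x hx hx'
    have h1 := (Finset.mem_filter.mp (hT hx)).2
    have h2 := (Finset.mem_filter.mp (hU hx')).2
    omega
  set P := (Finset.powersetCard 3 A ×ˢ Finset.powersetCard 1 B)
    ∪ (Finset.powersetCard 1 A ×ˢ Finset.powersetCard 3 B) with hP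
  have hPc : P.card = m.choose 3 * (n - m) + (n - m).choose 3 * m := by
    rw [hP, Finset.card_union_of_disjoint]
    · simp only [Finset.card_product, Finset.card_powersetCard, hAc, hBc, Nat.choose_one_right]
      ring
    · rw [Finset.disjoint_left]
      rintro ⟨T, U⟩ h h'
      simp only [Finset.mem_product, Finset.mem_powersetCard] at h h'
      omega
  have hPmem : ∀ x ∈ P, x.1 ⊆ A ∧ x.2 ⊆ B ∧ x.1.card * x.2.card = 3 ∧
      x.1.card + x.2.card = 4 := by
    rintro ⟨T, U⟩ h
    simp only [hP, Finset.mem_union, Finset.mem_product, Finset.mem_powersetCard] at h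
    rcases h with ⟨⟨a, b⟩, c, d⟩ | ⟨⟨a, b⟩, c, d⟩ <;> simp only [a, b, c, d] <;> simp
  rw [← hPc, numKL]
  refine Finset.card_le_card_of_injOn (fun x => x.1 ∪ x.2) ?_ ?_
  · intro x hx
    obtain ⟨h1, h2, h3, h4⟩ := hPmem x hx
    obtain ⟨h5, h6⟩ := hSA _ x.1 x.2 h1 h2 rfl
    rw [Finset.mem_coe, Finset.mem_filter, Finset.mem_powersetCard, edgeCount_bip, h5, h6,
      Finset.card_union_of_disjoint (hdisj _ _ h1 h2)]
    exact ⟨⟨Finset.subset_univ _, h4⟩, h3⟩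
  · intro x hx y hy hxy
    obtain ⟨h1, h2, -, -⟩ := hPmem x hx
    obtain ⟨h3, h4, -, -⟩ := hPmem y hy
    obtain ⟨h5, h6⟩ := hSA _ x.1 x.2 h1 h2 rfl
    obtain ⟨h7, h8⟩ := hSA _ y.1 y.2 h3 h4 rfl
    have hxy' : x.1 ∪ x.2 = y.1 ∪ y.2 := hxy
    rw [hxy'] at h5 h6
    exact Prod.ext (h5.symm.trans h7) (h6.symm.trans h8)

end Lower

theorem six_mul_choose_three (k : ℕ) (hk : 2 ≤ k) :
    ((k : ℝ) - 2) ^ 3 ≤ 6 * (k.choose 3 : ℝ) := by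
  have h := Nat.pow_sub_le_descFactorial k 3
  rw [Nat.descFactorial_eq_factorial_mul_choose] at h
  have h' : (((k + 1 - 3 : ℕ) : ℝ)) ^ 3 ≤ 6 * (k.choose 3 : ℝ) := by exact_mod_cast h
  have e : ((k + 1 - 3 : ℕ) : ℝ) = (k : ℝ) - 2 := by
    rw [show k + 1 - 3 = k - 2 by omega, Nat.cast_sub hk]; norm_num
  rwa [e] at h'

theorem choose_four_ge (k : ℕ) (hk : 3 ≤ k) :
    ((k : ℝ) - 3) ^ 4 ≤ 24 * (k.choose 4 : ℝ) := by
  have h := Nat.pow_sub_le_descFactorial k 4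
  rw [Nat.descFactorial_eq_factorial_mul_choose] at h
  have h' : (((k + 1 - 4 : ℕ) : ℝ)) ^ 4 ≤ 24 * (k.choose 4 : ℝ) := by exact_mod_cast h
  have e : ((k + 1 - 4 : ℕ) : ℝ) = (k : ℝ) - 3 := by
    rw [show k + 1 - 4 = k - 3 by omega, Nat.cast_sub hk]; norm_num
  rwa [e] at h'

theorem choose_four_le (k : ℕ) : 24 * (k.choose 4 : ℝ) ≤ (k : ℝ) ^ 4 := by
  have h := Nat.descFactorial_le_pow k 4
  rw [Nat.descFactorial_eq_factorial_mul_choose] at h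
  exact_mod_cast h

theorem lamKL_le {n : ℕ} (hn : 4 ≤ n) (G : SimpleGraph (Fin n)) :
    lamKL 4 3 G ≤ (1 / 2) * ((n : ℝ) / ((n : ℝ) - 3)) ^ 4 := by
  have h1 : (48 * (numKL 4 3 G : ℝ)) ≤ (n : ℝ) ^ 4 := by
    exact_mod_cast numKL_le (by omega) G
  have h2 := choose_four_ge n (by omega)
  have hn' : (4 : ℝ) ≤ n := by exact_mod_cast hn
  have hpos : (0 : ℝ) < ((n : ℝ) - 3) ^ 4 := by
    have : (0 : ℝ) < (n : ℝ) - 3 := by linarith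
    positivity
  have hc : (0 : ℝ) < (n.choose 4 : ℝ) := by linarith
  rw [lamKL, div_pow, div_le_iff₀ hc]
  have h3 : (n : ℝ) ^ 4 ≤ (n : ℝ) ^ 4 / ((n : ℝ) - 3) ^ 4 * (24 * (n.choose 4 : ℝ)) := by
    rw [div_mul_eq_mul_div, le_div_iff₀ hpos]
    exact mul_le_mul_of_nonneg_left h2 (by positivity)
  linarith

theorem lamKL_bip_ge {n : ℕ} (hn : 6 ≤ n) :
    (1 / 2) * (((n : ℝ) - 5) / (n : ℝ)) ^ 4 ≤ lamKL 4 3 (bip n (n / 2)) := by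
  have h1 : (((n / 2).choose 3 : ℝ) * ((n - n / 2 : ℕ) : ℝ)
      + ((n - n / 2).choose 3 : ℝ) * ((n / 2 : ℕ) : ℝ)) ≤ (numKL 4 3 (bip n (n / 2)) : ℝ) := by
    exact_mod_cast numKL_bip n (n / 2) (by omega)
  set m := n / 2 with hm
  set k := n - n / 2 with hk
  have hn' : (6 : ℝ) ≤ n := by exact_mod_cast hn
  have hm2 : (n : ℝ) - 1 ≤ 2 * (m : ℝ) := by
    have : n ≤ 2 * m + 1 := by omega
    have : (n : ℝ) ≤ 2 * m + 1 := by exact_mod_cast this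
    linarith
  have hk2 : (n : ℝ) - 1 ≤ 2 * (k : ℝ) := by
    have : n ≤ 2 * k + 1 := by omega
    have : (n : ℝ) ≤ 2 * k + 1 := by exact_mod_cast this
    linarith
  have c1 := six_mul_choose_three m (by omega)
  have c2 := six_mul_choose_three k (by omega)
  have g : ∀ t : ℝ, (n : ℝ) - 1 ≤ 2 * t → (((n : ℝ) - 5) / 2) ^ 3 ≤ (t - 2) ^ 3 := by
    intro t ht
    exact pow_le_pow_left₀ (by linarith) (by linarith) 3
  have hq : (0 : ℝ) ≤ (((n : ℝ) - 5) / 2) ^ 3 := pow_nonneg (by linarith) 3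
  have d1 : (((n : ℝ) - 5) / 2) ^ 3 * (((n : ℝ) - 5) / 2) ≤ 6 * (m.choose 3 : ℝ) * (k : ℝ) :=
    mul_le_mul ((g m hm2).trans c1) (by linarith) (by linarith) (by positivity)
  have d2 : (((n : ℝ) - 5) / 2) ^ 3 * (((n : ℝ) - 5) / 2) ≤ 6 * (k.choose 3 : ℝ) * (m : ℝ) :=
    mul_le_mul ((g k hk2).trans c2) (by linarith) (by linarith) (by positivity)
  have h2 : ((n : ℝ) - 5) ^ 4 ≤ 48 * (numKL 4 3 (bip n m) : ℝ) := by
    have : ((n : ℝ) - 5) ^ 4 = 8 * ((((n : ℝ) - 5) / 2) ^ 3 * (((n : ℝ) - 5) / 2)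
      + (((n : ℝ) - 5) / 2) ^ 3 * (((n : ℝ) - 5) / 2)) := by ring
    linarith
  have h3 := choose_four_le n
  have hc : (0 : ℝ) < (n.choose 4 : ℝ) := by
    exact_mod_cast Nat.choose_pos (by omega)
  have hn4 : (0 : ℝ) < (n : ℝ) ^ 4 := by positivity
  rw [lamKL, div_pow, le_div_iff₀ hc]
  have h4 : ((n : ℝ) - 5) ^ 4 / (n : ℝ) ^ 4 * (24 * (n.choose 4 : ℝ)) ≤ ((n : ℝ) - 5) ^ 4 := by
    rw [div_mul_eq_mul_div, div_le_iff₀ hn4]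
    exact mul_le_mul_of_nonneg_left h3 (by positivity)
  linarith

theorem tendsto_ratio (c : ℝ) :
    Filter.Tendsto (fun n : ℕ => ((n : ℝ) - c) / (n : ℝ)) Filter.atTop (nhds 1) := by
  have h : Filter.Tendsto (fun n : ℕ => 1 - c / (n : ℝ)) Filter.atTop (nhds (1 - 0)) :=
    tendsto_const_nhds.sub (tendsto_const_div_atTop_nhds_zero_nat c)
  rw [sub_zero] at h
  refine h.congr' ?_
  filter_upwards [Filter.eventually_gt_atTop 0] with n hn
  have : (n : ℝ) ≠ 0 := by positivity
  field_simp

theorem edge_inducibility_4_3 :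
    Filter.Tendsto (fun n => lamKLmax 4 3 n) Filter.atTop (nhds (1/2)) := by
  have hlo : Filter.Tendsto (fun n : ℕ => (1 / 2 : ℝ) * (((n : ℝ) - 5) / (n : ℝ)) ^ 4)
      Filter.atTop (nhds (1 / 2)) := by
    simpa using ((tendsto_ratio 5).pow 4).const_mul (1 / 2 : ℝ)
  have hhi : Filter.Tendsto (fun n : ℕ => (1 / 2 : ℝ) * ((n : ℝ) / ((n : ℝ) - 3)) ^ 4)
      Filter.atTop (nhds (1 / 2)) := by
    have h := (((tendsto_ratio 3).inv₀ one_ne_zero).pow 4).const_mul (1 / 2 : ℝ)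
    simpa [inv_div] using h
  refine tendsto_of_tendsto_of_tendsto_of_le_of_le' hlo hhi ?_ ?_
  · filter_upwards [Filter.eventually_ge_atTop 6] with n hn
    refine (lamKL_bip_ge hn).trans ?_
    exact le_ciSup (f := fun G : SimpleGraph (Fin n) => lamKL 4 3 G)
      (Set.finite_range _).bddAbove (bip n (n / 2))
  · filter_upwards [Filter.eventually_ge_atTop 6] with n hn
    exact ciSup_le fun G => lamKL_le (by omega) G
end

section
/- For every ε > 0 there exist δ > 0 and n₀ such that every simple graph G with n ≥ n₀ vertices satisfying λ_{4,3}(G) ≥ 1/2 − δ also satisfies λ_{4,1}(G) ≤ ε and λ_{4,5}(G) ≤ ε. -/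
open Finset
open scoped Classical

set_option linter.unusedVariables false

/-- Sparse multilinear polynomials in sign variables: `node a b` stands for `a + s * b`,
where `s` is the current variable and `a`, `b` only involve later variables. -/
inductive SPoly where
  | const (k : ℤ) : SPoly
  | node (a b : SPoly) : SPoly

namespace SPoly

/-- Evaluate an integer to constructor form before continuing. -/
noncomputable def forceNat {α : Type} (m : ℕ) (k : ℕ → α) : α :=
  Nat.rec (motive := fun _ => α) (k 0) (fun j _ => k (j + 1)) m

noncomputable def mk (z : ℤ) : SPoly :=
  Int.rec (motive := fun _ => SPoly) (fun m => forceNat m fun m => const (Int.ofNat m))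
    (fun m => forceNat m fun m => const (Int.negSucc m)) z

noncomputable def addC (k : ℤ) (t : SPoly) : SPoly :=
  SPoly.rec (motive := fun _ => SPoly) (fun j => mk (k + j)) (fun _ b iha _ => node iha b) t

noncomputable def add (t : SPoly) : SPoly → SPoly :=
  SPoly.rec (motive := fun _ => SPoly → SPoly) (fun k u => addC k u)
    (fun a b iha ihb u =>
      SPoly.rec (motive := fun _ => SPoly) (fun k => node (addC k a) b)
        (fun a_q b_q _ _ => node (iha a_q) (ihb b_q)) u) t

noncomputable def smul (k : ℤ) (t : SPoly) : SPoly :=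
  SPoly.rec (motive := fun _ => SPoly) (fun j => mk (k * j)) (fun _ _ iha ihb => node iha ihb) t

noncomputable def smulZ (k : ℤ) (t : SPoly) : SPoly :=
  if k = 0 then const 0 else smul k t

noncomputable def mul (t : SPoly) : SPoly → SPoly :=
  SPoly.rec (motive := fun _ => SPoly → SPoly) (fun k u => smulZ k u)
    (fun a b iha ihb u =>
      SPoly.rec (motive := fun _ => SPoly) (fun k => smulZ k (node a b))
        (fun a_q b_q _ _ => node (add (iha a_q) (ihb b_q)) (add (iha b_q) (ihb a_q))) u) t

noncomputable def force {α : Type} (t : SPoly) : (SPoly → α) → α :=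
  SPoly.rec (motive := fun _ => (SPoly → α) → α) (fun k f => f (const k))
    (fun _ _ iha ihb f => iha fun a => ihb fun b => f (node a b)) t

noncomputable def var (k : ℕ) : SPoly :=
  Nat.rec (motive := fun _ => SPoly) (node (const 0) (const 1)) (fun _ ih => node ih (const 0)) k

noncomputable def eval (t : SPoly) : (ℕ → ℤ) → ℤ :=
  SPoly.rec (motive := fun _ => (ℕ → ℤ) → ℤ) (fun k _ => k)
    (fun _ _ iha ihb s => iha (fun i => s (i + 1)) + s 0 * ihb (fun i => s (i + 1))) t

/-- All values of the polynomial on sign vectors are `≤ 0`. -/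
noncomputable def check (d : ℕ) : SPoly → Bool :=
  Nat.rec (motive := fun _ => SPoly → Bool)
    (fun t => SPoly.rec (motive := fun _ => Bool) (fun k => decide (k ≤ 0)) (fun _ _ _ _ => false) t)
    (fun _ ih t => SPoly.rec (motive := fun _ => Bool) (fun k => decide (k ≤ 0))
      (fun a b _ _ => ih (add a b) && ih (add a (smul (-1) b))) t) d

@[simp] theorem eval_const (k : ℤ) (s) : eval (const k) s = k := rfl
@[simp] theorem eval_node (a b : SPoly) (s) :
    eval (node a b) s = eval a (fun i => s (i + 1)) + s 0 * eval b (fun i => s (i + 1)) := rfl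

theorem forceNat_eq {α : Type} (m : ℕ) (k : ℕ → α) : forceNat m k = k m := by
  cases m <;> rfl

@[simp] theorem mk_eq (z : ℤ) : mk z = const z := by
  cases z <;> simp [mk, forceNat_eq]

theorem force_eq {α : Type} (t : SPoly) (f : SPoly → α) : force t f = f t := by
  induction t generalizing f with
  | const k => rfl
  | node a b iha ihb =>
    change force a (fun a_q => force b fun b_q => f (node a_q b_q)) = _
    rw [iha, ihb]

@[simp] theorem eval_addC (k : ℤ) (t : SPoly) (s) : eval (addC k t) s = k + eval t s := by
  induction t generalizing s with
  | const j => simp [addC]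
  | node a b iha ihb =>
    change eval (node (addC k a) b) s = _
    simp [iha]; ring

@[simp] theorem eval_add (t u : SPoly) (s) : eval (add t u) s = eval t s + eval u s := by
  induction t generalizing s u with
  | const j => exact eval_addC j u s
  | node a b iha ihb =>
    cases u with
    | const k =>
      change eval (node (addC k a) b) s = _
      simp; ring
    | node a_q b_q =>
      change eval (node (add a a_q) (add b b_q)) s = _
      simp [iha, ihb]; ring

@[simp] theorem eval_smul (k : ℤ) (t : SPoly) (s) : eval (smul k t) s = k * eval t s := by
  induction t generalizing s with
  | const j => simp [smul]
  | node a b iha ihb =>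
    change eval (node (smul k a) (smul k b)) s = _
    simp [iha, ihb]; ring

@[simp] theorem eval_smulZ (k : ℤ) (t : SPoly) (s) : eval (smulZ k t) s = k * eval t s := by
  unfold smulZ; split_ifs with h <;> simp [h]

theorem eval_mul (t u : SPoly) (s : ℕ → ℤ) (hs : ∀ i, s i * s i = 1) :
    eval (mul t u) s = eval t s * eval u s := by
  induction t generalizing s u with
  | const j => exact eval_smulZ j u s
  | node a b iha ihb =>
    cases u with
    | const k =>
      change eval (smulZ k (node a b)) s = _
      rw [eval_smulZ, eval_const]; ring
    | node a_q b_q =>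
      change eval (node (add (mul a a_q) (mul b b_q)) (add (mul a b_q) (mul b a_q))) s = _
      have h1 := iha a_q (fun i => s (i + 1)) (fun i => hs _)
      have h2 := iha b_q (fun i => s (i + 1)) (fun i => hs _)
      have h3 := ihb a_q (fun i => s (i + 1)) (fun i => hs _)
      have h4 := ihb b_q (fun i => s (i + 1)) (fun i => hs _)
      simp only [eval_node, eval_add, h1, h2, h3, h4]
      linear_combination (-(eval b fun i => s (i + 1)) * (eval b_q fun i => s (i + 1))) * hs 0

@[simp] theorem eval_var (k : ℕ) (s) : eval (var k) s = s k := by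
  induction k generalizing s with
  | zero => change eval (node (const 0) (const 1)) s = _; simp
  | succ k ih => change eval (node (var k) (const 0)) s = _; simp [ih]

theorem check_sound (d : ℕ) (t : SPoly) (h : check d t = true) (s : ℕ → ℤ)
    (hs : ∀ i, s i = 1 ∨ s i = -1) : eval t s ≤ 0 := by
  induction d generalizing t s with
  | zero =>
    cases t with
    | const k => exact of_decide_eq_true h
    | node a b => exact absurd h (by change ¬ (false = true); simp)
  | succ d ih =>
    cases t with
    | const k => exact of_decide_eq_true h
    | node a b =>
      change (check d (add a b) && check d (add a (smul (-1) b))) = true at h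
      rw [Bool.and_eq_true] at h
      have h1 := ih _ h.1 (fun i => s (i + 1)) (fun i => hs _)
      have h2 := ih _ h.2 (fun i => s (i + 1)) (fun i => hs _)
      rw [eval_add] at h1 h2
      rw [eval_smul] at h2
      rw [eval_node]
      rcases hs 0 with h0 | h0 <;> rw [h0] <;> linarith

end SPoly

/-- Edge index of a pair in `{0,…,5}`. -/
def eIdx (a b : ℕ) : ℕ := if a < b then b * (b - 1) / 2 + a else a * (a - 1) / 2 + b

/-- The operations used to write the certificate both over `ℤ` and over `SPoly`. -/
structure Ops (R : Type) where
  c : ℤ → R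
  add : R → R → R
  mul : R → R → R

def opsZ : Ops ℤ := ⟨id, (· + ·), (· * ·)⟩

noncomputable def opsP : Ops SPoly :=
  ⟨SPoly.const, SPoly.add, SPoly.mul⟩

namespace Ops
variable {R : Type} (o : Ops R)

def sub (a b : R) : R := o.add a (o.mul (o.c (-1)) b)

def s0 (τ p q r t e : R) : R := o.mul (o.c 2) (o.mul τ e)
def s1 (τ p q r t e : R) : R := o.mul (o.c 2) (o.mul τ (o.mul (o.mul p q) (o.mul (o.mul r t) e)))
def s2 (τ p q r t e : R) : R := o.mul (o.c 2) (o.sub (o.c 1) (o.mul (o.mul p q) (o.mul r t)))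
def s3 (τ p q r t e : R) : R :=
  o.sub (o.mul τ (o.add (o.add p q) (o.add r t)))
    (o.mul e (o.add (o.mul (o.mul p q) (o.add r t)) (o.mul (o.mul r t) (o.add p q))))
def a1 (τ p q r t e : R) : R := o.mul τ (o.sub (o.add q t) (o.add p r))
def a2 (τ p q r t e : R) : R := o.mul e (o.sub (o.add q t) (o.add p r))
def a3 (τ p q r t e : R) : R :=
  o.mul τ (o.add (o.mul (o.mul p q) (o.sub t r)) (o.mul (o.mul r t) (o.sub q p)))
def a4 (τ p q r t e : R) : R :=
  o.mul e (o.add (o.mul (o.mul p q) (o.sub t r)) (o.mul (o.mul r t) (o.sub q p)))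
def b1 (τ p q r t e : R) : R := o.sub (o.a1 τ p q r t e) (o.a4 τ p q r t e)
def b2 (τ p q r t e : R) : R := o.sub (o.a2 τ p q r t e) (o.a3 τ p q r t e)
def b3 (τ p q r t e : R) : R :=
  o.add (o.add (o.a1 τ p q r t e) (o.a2 τ p q r t e)) (o.add (o.a3 τ p q r t e) (o.a4 τ p q r t e))
def b4 (τ p q r t e : R) : R := o.mul (o.c 2) (o.sub (o.mul q t) (o.mul p r))
def b5 (τ p q r t e : R) : R := o.mul (o.mul (o.c 2) (o.mul τ e)) (o.sub (o.mul q t) (o.mul p r))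

/-- The bilinear form with the (positive definite) certificate matrix. -/
def form (u0 u1 u2 u3 v1 v2 v3 v4 v5 u0_q u1_q u2_q u3_q v1_q v2_q v3_q v4_q v5_q : R) : R :=
  let l2 := fun (a : ℤ) (x : R) (b : ℤ) (y : R) => o.add (o.mul (o.c a) x) (o.mul (o.c b) y)
  o.add
    (o.add
      (o.add (o.mul u0 (l2 194400 u0_q (-6000) u2_q))
        (o.mul u1 (o.add (l2 93600 u1_q 39600 u2_q) (o.mul (o.c 16800) u3_q))))
      (o.add (o.mul u2 (o.add (l2 (-6000) u0_q 39600 u1_q) (l2 18240 u2_q 13500 u3_q)))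
        (o.mul u3 (o.add (l2 16800 u1_q 13500 u2_q) (o.mul (o.c 36480) u3_q)))))
    (o.add
      (o.add
        (o.mul v1 (o.add (o.add (l2 47400 v1_q 16800 v2_q) (l2 26400 v3_q 4668 v4_q))
          (o.mul (o.c (-25800)) v5_q)))
        (o.mul v2 (o.add (l2 16800 v1_q 63000 v2_q) (o.mul (o.c 8448) v3_q))))
      (o.add
        (o.add (o.mul v3 (o.add (o.add (l2 26400 v1_q 8448 v2_q) (l2 23400 v3_q (-19422) v4_q))
          (o.mul (o.c (-15600)) v5_q)))
          (o.mul v4 (o.add (l2 4668 v1_q (-19422) v3_q) (o.mul (o.c 57600) v4_q))))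
        (o.mul v5 (o.add (l2 (-25800) v1_q (-15600) v3_q) (o.mul (o.c 15750) v5_q)))))

/-- The certificate term for two base vertices and two pairs. -/
def cfg {ι : Type} (s : ι → ι → R) (x y z w z_q w_q : ι) : R :=
  let ap := fun (f : R → R → R → R → R → R → R) =>
    f (s x y) (s x z) (s y z) (s x w) (s y w) (s z w)
  let ap_q := fun (f : R → R → R → R → R → R → R) =>
    f (s x y) (s x z_q) (s y z_q) (s x w_q) (s y w_q) (s z_q w_q)
  o.form (ap o.s0) (ap o.s1) (ap o.s2) (ap o.s3) (ap o.b1) (ap o.b2) (ap o.b3) (ap o.b4) (ap o.b5)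
    (ap_q o.s0) (ap_q o.s1) (ap_q o.s2) (ap_q o.s3) (ap_q o.b1) (ap_q o.b2) (ap_q o.b3) (ap_q o.b4)
    (ap_q o.b5)

/-- `288000` times (`24` if three edges, `1` if one or five edges, `0` otherwise). -/
def quad {ι : Type} (s : ι → ι → R) (x y z w : ι) : R :=
  let σ := o.add (o.add (o.add (s x y) (s x z)) (o.add (s y z) (s x w))) (o.add (s y w) (s z w))
  let q := o.mul σ σ
  o.mul (o.c (-25)) (o.mul (o.mul (o.add q (o.c (-4))) (o.add q (o.c (-36))))
    (o.add (o.mul (o.c 123) q) (o.c (-1920))))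

def sumL (l : List R) : R := List.rec (motive := fun _ => R) (o.c 0) (fun a _ ih => o.add a ih) l

end Ops

def cfgList : List (Fin 6 → Fin 6) := [
  ![0, 1, 2, 3, 4, 5],
  ![0, 1, 2, 4, 3, 5],
  ![0, 1, 2, 5, 3, 4],
  ![0, 2, 1, 3, 4, 5],
  ![0, 2, 1, 4, 3, 5],
  ![0, 2, 1, 5, 3, 4],
  ![0, 3, 1, 2, 4, 5],
  ![0, 3, 1, 4, 2, 5],
  ![0, 3, 1, 5, 2, 4],
  ![0, 4, 1, 2, 3, 5],
  ![0, 4, 1, 3, 2, 5],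
  ![0, 4, 1, 5, 2, 3],
  ![0, 5, 1, 2, 3, 4],
  ![0, 5, 1, 3, 2, 4],
  ![0, 5, 1, 4, 2, 3],
  ![1, 2, 0, 3, 4, 5],
  ![1, 2, 0, 4, 3, 5],
  ![1, 2, 0, 5, 3, 4],
  ![1, 3, 0, 2, 4, 5],
  ![1, 3, 0, 4, 2, 5],
  ![1, 3, 0, 5, 2, 4],
  ![1, 4, 0, 2, 3, 5],
  ![1, 4, 0, 3, 2, 5],
  ![1, 4, 0, 5, 2, 3],
  ![1, 5, 0, 2, 3, 4],
  ![1, 5, 0, 3, 2, 4],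
  ![1, 5, 0, 4, 2, 3],
  ![2, 3, 0, 1, 4, 5],
  ![2, 3, 0, 4, 1, 5],
  ![2, 3, 0, 5, 1, 4],
  ![2, 4, 0, 1, 3, 5],
  ![2, 4, 0, 3, 1, 5],
  ![2, 4, 0, 5, 1, 3],
  ![2, 5, 0, 1, 3, 4],
  ![2, 5, 0, 3, 1, 4],
  ![2, 5, 0, 4, 1, 3],
  ![3, 4, 0, 1, 2, 5],
  ![3, 4, 0, 2, 1, 5],
  ![3, 4, 0, 5, 1, 2],
  ![3, 5, 0, 1, 2, 4],
  ![3, 5, 0, 2, 1, 4],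
  ![3, 5, 0, 4, 1, 2],
  ![4, 5, 0, 1, 2, 3],
  ![4, 5, 0, 2, 1, 3],
  ![4, 5, 0, 3, 1, 2]]
def quadList : List (Fin 6 → Fin 6) := [
  ![2, 3, 4, 5, 0, 1],
  ![1, 3, 4, 5, 0, 2],
  ![1, 2, 4, 5, 0, 3],
  ![1, 2, 3, 5, 0, 4],
  ![1, 2, 3, 4, 0, 5],
  ![0, 3, 4, 5, 1, 2],
  ![0, 2, 4, 5, 1, 3],
  ![0, 2, 3, 5, 1, 4],
  ![0, 2, 3, 4, 1, 5],
  ![0, 1, 4, 5, 2, 3],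
  ![0, 1, 3, 5, 2, 4],
  ![0, 1, 3, 4, 2, 5],
  ![0, 1, 2, 5, 3, 4],
  ![0, 1, 2, 4, 3, 5],
  ![0, 1, 2, 3, 4, 5]]

def Ops.total {R : Type} (o : Ops R) (s : ℕ → ℕ → R) : R :=
  o.add (o.add (o.sumL (cfgList.map fun f => o.cfg s (f 0) (f 1) (f 2) (f 3) (f 4) (f 5)))
    (o.sumL (quadList.map fun f => o.quad s (f 0) (f 1) (f 2) (f 3)))) (o.c (-51840000))

theorem check_total : SPoly.check 15 (opsP.total fun a b => SPoly.var (eIdx a b)) = true := by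
  decide +kernel

namespace Ops

/-- Evaluation commutes with the certificate expressions. -/
theorem eval_cfg (σ : ℕ → ℤ) (hs : ∀ i, σ i * σ i = 1) (s : ℕ → ℕ → SPoly) (x y z w z_q w_q : ℕ) :
    SPoly.eval (opsP.cfg s x y z w z_q w_q) σ
      = opsZ.cfg (fun a b => SPoly.eval (s a b) σ) x y z w z_q w_q := by
  have hm := fun t u => SPoly.eval_mul t u σ hs
  simp only [cfg, form, s0, s1, s2, s3, b1, b2, b3, b4, b5, a1, a2, a3, a4, sub, opsP, opsZ,
    SPoly.eval_add, hm, SPoly.eval_const, id]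

theorem eval_quad (σ : ℕ → ℤ) (hs : ∀ i, σ i * σ i = 1) (s : ℕ → ℕ → SPoly) (x y z w : ℕ) :
    SPoly.eval (opsP.quad s x y z w) σ
      = opsZ.quad (fun a b => SPoly.eval (s a b) σ) x y z w := by
  have hm := fun t u => SPoly.eval_mul t u σ hs
  simp only [quad, opsP, opsZ, SPoly.eval_add, hm, SPoly.eval_const, id]

theorem eval_sumL (σ : ℕ → ℤ) (l : List SPoly) :
    SPoly.eval (opsP.sumL l) σ = (l.map fun t => SPoly.eval t σ).sum := by
  induction l with
  | nil => rfl
  | cons a l ih =>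
    change SPoly.eval (SPoly.add a (opsP.sumL l)) σ = _
    rw [SPoly.eval_add, ih]; simp

end Ops

/-- The pair with a given edge index. -/
def pairA (k : ℕ) : Fin 6 := [0, 0, 1, 0, 1, 2, 0, 1, 2, 3, 0, 1, 2, 3, 4].getD k 0
def pairB (k : ℕ) : Fin 6 := [1, 2, 2, 3, 3, 3, 4, 4, 4, 4, 5, 5, 5, 5, 5].getD k 1

theorem pair_spec : ∀ a b : Fin 6, a < b → pairA (eIdx a b) = a ∧ pairB (eIdx a b) = b := by
  decide

theorem eIdx_comm : ∀ a b : Fin 6, eIdx a b = eIdx b a := by decide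

theorem cfgList_inj : ∀ f ∈ cfgList, Function.Injective f := by
  have h : (cfgList.all fun f => decide (∀ a b : Fin 6, f a = f b → a = b)) = true := by
    decide +kernel
  rw [List.all_eq_true] at h
  exact fun f hf a b => of_decide_eq_true (h f hf) a b

theorem quadList_inj : ∀ f ∈ quadList, Function.Injective f := by
  have h : (quadList.all fun f => decide (∀ a b : Fin 6, f a = f b → a = b)) = true := by
    decide +kernel
  rw [List.all_eq_true] at h
  exact fun f hf a b => of_decide_eq_true (h f hf) a b

section Glue
variable {α : Type}

theorem pointwise (S : α → α → ℤ) (hS : ∀ a b, S a b = 1 ∨ S a b = -1)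
    (hsym : ∀ a b, S a b = S b a) (v : Fin 6 → α) :
    (cfgList.map fun f => opsZ.cfg S (v (f 0)) (v (f 1)) (v (f 2)) (v (f 3)) (v (f 4)) (v (f 5))).sum
    + (quadList.map fun f => opsZ.quad S (v (f 0)) (v (f 1)) (v (f 2)) (v (f 3))).sum
    ≤ 51840000 := by
  set σ : ℕ → ℤ := fun k => S (v (pairA k)) (v (pairB k)) with hσ
  have h1 : ∀ i, σ i = 1 ∨ σ i = -1 := fun i => hS _ _
  have h2 : ∀ i, σ i * σ i = 1 := fun i => by rcases h1 i with h | h <;> rw [h] <;> rfl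
  have key : ∀ a b : Fin 6, a ≠ b → σ (eIdx a b) = S (v a) (v b) := by
    intro a b hab
    rcases lt_or_gt_of_ne hab with h | h
    · have := pair_spec a b h
      simp only [hσ, this.1, this.2]
    · have := pair_spec b a h
      rw [eIdx_comm]
      simp only [hσ, this.1, this.2]
      exact hsym _ _
  have h := SPoly.check_sound 15 _ check_total σ h1
  unfold Ops.total at h
  have ha : ∀ t u, SPoly.eval (opsP.add t u) σ = SPoly.eval t σ + SPoly.eval u σ :=
    fun t u => SPoly.eval_add t u σ
  have hc : ∀ k, SPoly.eval (opsP.c k) σ = k := fun k => SPoly.eval_const k σ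
  rw [ha, ha, hc, Ops.eval_sumL, Ops.eval_sumL,
    List.map_map, List.map_map] at h
  have e1 : (cfgList.map ((fun t => SPoly.eval t σ) ∘ fun f : Fin 6 → Fin 6 =>
      opsP.cfg (fun a b => SPoly.var (eIdx a b)) (f 0 : ℕ) (f 1) (f 2) (f 3) (f 4) (f 5)))
      = cfgList.map fun f =>
        opsZ.cfg S (v (f 0)) (v (f 1)) (v (f 2)) (v (f 3)) (v (f 4)) (v (f 5)) := by
    apply List.map_congr_left
    intro f hf
    have hi := cfgList_inj f hf
    have k : ∀ i j : Fin 6, i ≠ j → σ (eIdx (f i) (f j)) = S (v (f i)) (v (f j)) :=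
      fun i j hij => key _ _ (hi.ne hij)
    simp only [Function.comp]
    rw [Ops.eval_cfg σ h2]
    simp only [Ops.cfg, SPoly.eval_var]
    rw [k 0 1 (by decide), k 0 2 (by decide), k 1 2 (by decide), k 0 3 (by decide),
      k 1 3 (by decide), k 2 3 (by decide), k 0 4 (by decide), k 1 4 (by decide),
      k 0 5 (by decide), k 1 5 (by decide), k 4 5 (by decide)]
  have e2 : (quadList.map ((fun t => SPoly.eval t σ) ∘ fun f : Fin 6 → Fin 6 =>
      opsP.quad (fun a b => SPoly.var (eIdx a b)) (f 0 : ℕ) (f 1) (f 2) (f 3)))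
      = quadList.map fun f => opsZ.quad S (v (f 0)) (v (f 1)) (v (f 2)) (v (f 3)) := by
    apply List.map_congr_left
    intro f hf
    have hi := quadList_inj f hf
    have k : ∀ i j : Fin 6, i ≠ j → σ (eIdx (f i) (f j)) = S (v (f i)) (v (f j)) :=
      fun i j hij => key _ _ (hi.ne hij)
    simp only [Function.comp]
    rw [Ops.eval_quad σ h2]
    simp only [Ops.quad, SPoly.eval_var]
    rw [k 0 1 (by decide), k 0 2 (by decide), k 1 2 (by decide), k 0 3 (by decide),
      k 1 3 (by decide), k 2 3 (by decide)]
  rw [e1, e2] at h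
  linarith

variable [Fintype α]

theorem sum_reindex (f : Fin 6 → Fin 6) (hf : Function.Injective f) (h : (Fin 6 → α) → ℤ) :
    ∑ v : Fin 6 → α, h (fun i => v (f i)) = ∑ v : Fin 6 → α, h v := by
  let e : Fin 6 ≃ Fin 6 := Equiv.ofBijective f (Finite.injective_iff_bijective.mp hf)
  exact (Equiv.arrowCongr e.symm (Equiv.refl α)).sum_comp h

theorem sum_list {β γ : Type} [Fintype β] (l : List γ) (h : γ → β → ℤ) (c : ℤ)
    (hl : ∀ f ∈ l, ∑ v, h f v = c) :
    ∑ v, (l.map fun f => h f v).sum = l.length * c := by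
  induction l with
  | nil => simp
  | cons a l ih =>
    simp only [List.map_cons, List.sum_cons, Finset.sum_add_distrib, List.length_cons]
    rw [ih fun f hf => hl f (List.mem_cons_of_mem _ hf), hl a List.mem_cons_self]
    push_cast; ring

theorem sum_fin_cons {k : ℕ} (h : (Fin (k + 1) → α) → ℤ) :
    ∑ v, h v = ∑ x, ∑ w : Fin k → α, h (Fin.cons x w) := by
  rw [← Fintype.sum_prod_type' (fun x (w : Fin k → α) => h (Fin.cons x w))]
  exact ((Fin.consEquiv (fun _ => α)).sum_comp h).symm

theorem sum6 (F : α → α → α → α → α → α → ℤ) :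
    ∑ v : Fin 6 → α, F (v 0) (v 1) (v 2) (v 3) (v 4) (v 5)
      = ∑ x, ∑ y, ∑ z, ∑ w, ∑ z_q, ∑ w_q, F x y z w z_q w_q := by
  simp only [sum_fin_cons, Fintype.sum_unique]
  rfl

theorem sum4 (F : α → α → α → α → ℤ) :
    ∑ v : Fin 4 → α, F (v 0) (v 1) (v 2) (v 3) = ∑ x, ∑ y, ∑ z, ∑ w, F x y z w := by
  simp only [sum_fin_cons, Fintype.sum_unique]
  rfl

theorem form_nonneg (u0 u1 u2 u3 v1 v2 v3 v4 v5 : ℤ) :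
    0 ≤ opsZ.form u0 u1 u2 u3 v1 v2 v3 v4 v5 u0 u1 u2 u3 v1 v2 v3 v4 v5 := by
  have e : ((opsZ.form u0 u1 u2 u3 v1 v2 v3 v4 v5 u0 u1 u2 u3 v1 v2 v3 v4 v5 : ℤ) : ℚ)
    = 576000 * (27/80 * (u0 - 5/162 * u2) ^ 2 + 13/80 * (u1 + 11/26 * u2 + 7/39 * u3) ^ 2
      + 1427/631800 * (u2 + 112185/22832 * u3) ^ 2 + 2347153/657561600 * u3 ^ 2
      + 79/960 * (v1 + 28/79 * v2 + 44/79 * v3 + 389/3950 * v4 - 43/79 * v5) ^ 2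
      + 7511/75840 * (v2 - 2992/187775 * v3 - 778/26825 * v4 + 172/1073 * v5) ^ 2
      + 22641803/1502200000 * (v3 - 690018707/271701636 * v4 - 8486450/67925409 * v5) ^ 2
      + 1243167882661/652083926400000 * (v4 + 58143738400/1243167882661 * v5) ^ 2
      + 57035072127/318250977961216 * v5 ^ 2) := by
    simp only [Ops.form, opsZ, id]
    push_cast
    ring
  have : (0 : ℚ) ≤ ((opsZ.form u0 u1 u2 u3 v1 v2 v3 v4 v5 u0 u1 u2 u3 v1 v2 v3 v4 v5 : ℤ) : ℚ) := by
    rw [e]; positivity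
  exact_mod_cast this

theorem form_sum {β : Type} [Fintype β] (u0 u1 u2 u3 v1 v2 v3 v4 v5 : β → ℤ) :
    0 ≤ ∑ p, ∑ q, opsZ.form (u0 p) (u1 p) (u2 p) (u3 p) (v1 p) (v2 p) (v3 p) (v4 p) (v5 p)
      (u0 q) (u1 q) (u2 q) (u3 q) (v1 q) (v2 q) (v3 q) (v4 q) (v5 q) := by
  have h := form_nonneg (∑ p, u0 p) (∑ p, u1 p) (∑ p, u2 p) (∑ p, u3 p) (∑ p, v1 p) (∑ p, v2 p)
    (∑ p, v3 p) (∑ p, v4 p) (∑ p, v5 p)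
  convert h using 1
  simp only [Ops.form, opsZ, id, Finset.sum_add_distrib, ← Finset.mul_sum, ← Finset.sum_mul]

theorem cfg_sum_nonneg (S : α → α → ℤ) :
    0 ≤ ∑ x, ∑ y, ∑ z, ∑ w, ∑ z_q, ∑ w_q, opsZ.cfg S x y z w z_q w_q := by
  refine Finset.sum_nonneg fun x _ => Finset.sum_nonneg fun y _ => ?_
  have h := form_sum (β := α × α)
    (fun p => opsZ.s0 (S x y) (S x p.1) (S y p.1) (S x p.2) (S y p.2) (S p.1 p.2))
    (fun p => opsZ.s1 (S x y) (S x p.1) (S y p.1) (S x p.2) (S y p.2) (S p.1 p.2))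
    (fun p => opsZ.s2 (S x y) (S x p.1) (S y p.1) (S x p.2) (S y p.2) (S p.1 p.2))
    (fun p => opsZ.s3 (S x y) (S x p.1) (S y p.1) (S x p.2) (S y p.2) (S p.1 p.2))
    (fun p => opsZ.b1 (S x y) (S x p.1) (S y p.1) (S x p.2) (S y p.2) (S p.1 p.2))
    (fun p => opsZ.b2 (S x y) (S x p.1) (S y p.1) (S x p.2) (S y p.2) (S p.1 p.2))
    (fun p => opsZ.b3 (S x y) (S x p.1) (S y p.1) (S x p.2) (S y p.2) (S p.1 p.2))
    (fun p => opsZ.b4 (S x y) (S x p.1) (S y p.1) (S x p.2) (S y p.2) (S p.1 p.2))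
    (fun p => opsZ.b5 (S x y) (S x p.1) (S y p.1) (S x p.2) (S y p.2) (S p.1 p.2))
  simp only [Fintype.sum_prod_type] at h
  exact h

theorem sum_lists (l m : List (Fin 6 → Fin 6)) (hl : ∀ f ∈ l, Function.Injective f)
    (hm : ∀ f ∈ m, Function.Injective f) (F : α → α → α → α → α → α → ℤ) (Q : α → α → α → α → ℤ)
    (K : ℤ)
    (h : ∀ v : Fin 6 → α,
      (l.map fun f => F (v (f 0)) (v (f 1)) (v (f 2)) (v (f 3)) (v (f 4)) (v (f 5))).sum
      + (m.map fun f => Q (v (f 0)) (v (f 1)) (v (f 2)) (v (f 3))).sum ≤ K) :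
    l.length * (∑ x, ∑ y, ∑ z, ∑ w, ∑ z_q, ∑ w_q, F x y z w z_q w_q)
      + m.length * ((Fintype.card α : ℤ) ^ 2 * ∑ x, ∑ y, ∑ z, ∑ w, Q x y z w)
      ≤ (Fintype.card α : ℤ) ^ 6 * K := by
  have h := Finset.sum_le_sum fun (v : Fin 6 → α) (_ : v ∈ Finset.univ) => h v
  rw [Finset.sum_add_distrib] at h
  rw [sum_list l
    (fun f (v : Fin 6 → α) => F (v (f 0)) (v (f 1)) (v (f 2)) (v (f 3)) (v (f 4)) (v (f 5)))
    (∑ v : Fin 6 → α, F (v 0) (v 1) (v 2) (v 3) (v 4) (v 5))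
    (fun f hf => sum_reindex f (hl f hf)
      (fun v => F (v 0) (v 1) (v 2) (v 3) (v 4) (v 5)))] at h
  rw [sum_list m
    (fun f (v : Fin 6 → α) => Q (v (f 0)) (v (f 1)) (v (f 2)) (v (f 3)))
    (∑ v : Fin 6 → α, Q (v 0) (v 1) (v 2) (v 3))
    (fun f hf => sum_reindex f (hm f hf)
      (fun v => Q (v 0) (v 1) (v 2) (v 3)))] at h
  rw [sum6 F, sum6 (fun x y z w _ _ => Q x y z w)] at h
  simp only [Finset.sum_const, Finset.card_univ, nsmul_eq_mul, Fintype.card_fun, Fintype.card_fin,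
    ← Finset.mul_sum] at h
  push_cast at h
  rw [pow_two, mul_assoc]
  exact h

theorem quad_sum_le [Nonempty α] (S : α → α → ℤ) (hS : ∀ a b, S a b = 1 ∨ S a b = -1)
    (hsym : ∀ a b, S a b = S b a) :
    ∑ v : Fin 4 → α, opsZ.quad S (v 0) (v 1) (v 2) (v 3) ≤ 3456000 * (Fintype.card α : ℤ) ^ 4 := by
  have h := sum_lists cfgList quadList cfgList_inj quadList_inj (opsZ.cfg S) (opsZ.quad S) 51840000
    (pointwise S hS hsym)
  have l1 : (cfgList.length : ℤ) = 45 := by simp [cfgList]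
  have l2 : (quadList.length : ℤ) = 15 := by simp [quadList]
  rw [l1, l2] at h
  rw [sum4 (opsZ.quad S)]
  have h0 := cfg_sum_nonneg S
  have hn : 0 < (Fintype.card α : ℤ) := by exact_mod_cast Fintype.card_pos
  have hn2 : 0 < (Fintype.card α : ℤ) ^ 2 := by positivity
  refine le_of_mul_le_mul_left ?_ hn2
  generalize (∑ x, ∑ y, ∑ z, ∑ w, ∑ z_q, ∑ w_q, opsZ.cfg S x y z w z_q w_q) = C at h h0
  generalize (∑ x, ∑ y, ∑ z, ∑ w, opsZ.quad S x y z w) = Q at h ⊢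
  generalize (Fintype.card α : ℤ) = n at h ⊢
  have e : n ^ 2 * (3456000 * n ^ 4) = 3456000 * n ^ 6 := by ring
  rw [e]
  linarith

end Glue

section Count
variable {n : ℕ} (G : SimpleGraph (Fin n))

/-- Sign matrix of a graph. -/
noncomputable def sgn (a b : Fin n) : ℤ := if G.Adj a b then 1 else -1

theorem sgn_cases (a b : Fin n) : sgn G a b = 1 ∨ sgn G a b = -1 := by
  unfold sgn; split_ifs <;> simp

theorem sgn_symm (a b : Fin n) : sgn G a b = sgn G b a := by
  simp only [sgn, G.adj_comm]

theorem sgn_self (a : Fin n) : sgn G a a = -1 := by simp [sgn]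

/-- Sum of the six signs. -/
noncomputable def ssum (v : Fin 4 → Fin n) : ℤ :=
  sgn G (v 0) (v 1) + sgn G (v 0) (v 2) + (sgn G (v 1) (v 2) + sgn G (v 0) (v 3))
    + (sgn G (v 1) (v 3) + sgn G (v 2) (v 3))

/-- The weight as a polynomial in the sum of signs. -/
def wt (t : ℤ) : ℤ := -25 * ((t * t + -4) * (t * t + -36) * (123 * (t * t) + -1920))

theorem quad_eq (v : Fin 4 → Fin n) :
    opsZ.quad (sgn G) (v 0) (v 1) (v 2) (v 3) = wt (ssum G v) := rfl

theorem ssum_full (v : Fin 4 → Fin n) :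
    ∑ i, ∑ j, sgn G (v i) (v j) = 2 * ssum G v - 4 := by
  simp only [Fin.sum_univ_four, sgn_self, ssum]
  rw [sgn_symm G (v 1) (v 0), sgn_symm G (v 2) (v 0), sgn_symm G (v 3) (v 0),
    sgn_symm G (v 2) (v 1), sgn_symm G (v 3) (v 1), sgn_symm G (v 3) (v 2)]
  ring

theorem ssum_perm (v : Fin 4 → Fin n) (π : Equiv.Perm (Fin 4)) :
    ssum G (fun i => v (π i)) = ssum G v := by
  have h1 := ssum_full G (fun i => v (π i))
  have h2 := ssum_full G v
  have h3 : ∑ i, ∑ j, sgn G (v (π i)) (v (π j)) = ∑ i, ∑ j, sgn G (v i) (v j) := by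
    rw [← Equiv.sum_comp π (fun i => ∑ j, sgn G (v i) (v j))]
    exact Finset.sum_congr rfl fun i _ => Equiv.sum_comp π (fun j => sgn G (v (π i)) (v j))
  linarith

theorem ssum_range (v : Fin 4 → Fin n) : ∃ k : ℕ, k ≤ 6 ∧ ssum G v = 2 * (k : ℤ) - 6 := by
  have hb : ∀ a b, ∃ k : ℕ, k ≤ 1 ∧ sgn G a b = 2 * (k : ℤ) - 1 := by
    intro a b
    rcases sgn_cases G a b with h | h
    · exact ⟨1, by norm_num, by rw [h]; norm_num⟩
    · exact ⟨0, by norm_num, by rw [h]; norm_num⟩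
  obtain ⟨k1, h1, e1⟩ := hb (v 0) (v 1)
  obtain ⟨k2, h2, e2⟩ := hb (v 0) (v 2)
  obtain ⟨k3, h3, e3⟩ := hb (v 1) (v 2)
  obtain ⟨k4, h4, e4⟩ := hb (v 0) (v 3)
  obtain ⟨k5, h5, e5⟩ := hb (v 1) (v 3)
  obtain ⟨k6, h6, e6⟩ := hb (v 2) (v 3)
  refine ⟨k1 + k2 + k3 + k4 + k5 + k6, by omega, ?_⟩
  rw [ssum, e1, e2, e3, e4, e5, e6]
  push_cast
  ring

theorem wt_val (k : ℕ) (hk : k ≤ 6) : wt (2 * (k : ℤ) - 6)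
    = 288000 * (24 * (if k = 3 then 1 else 0) + (if k = 1 then 1 else 0)
      + (if k = 5 then 1 else 0)) := by
  interval_cases k <;> norm_num [wt]

theorem wt_nonneg (v : Fin 4 → Fin n) : 0 ≤ wt (ssum G v) := by
  obtain ⟨k, hk, h⟩ := ssum_range G v
  rw [h, wt_val k hk]
  split_ifs <;> norm_num

theorem edgeCount_eq (e : Fin 4 ↪o Fin n) (S : Finset (Fin n)) (he : Set.range e = S) :
    ssum G e = 2 * (edgeCount G S : ℤ) - 6 := by
  have h : edgeCount G S
      = ∑ i : Fin 4, ∑ j : Fin 4, if i < j ∧ G.Adj (e i) (e j) then 1 else 0 := by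
    rw [← Fintype.sum_prod_type' (fun i j : Fin 4 => if i < j ∧ G.Adj (e i) (e j) then 1 else 0),
      ← Finset.card_filter]
    unfold edgeCount
    symm
    refine Finset.card_bij (fun p _ => (e p.1, e p.2)) ?_ ?_ ?_
    · intro p hp
      simp only [Finset.mem_filter, Finset.mem_univ, true_and] at hp ⊢
      have hm : ∀ i, e i ∈ S := fun i => by
        rw [← Finset.mem_coe, ← he]; exact Set.mem_range_self i
      exact ⟨hm _, hm _, e.lt_iff_lt.mpr hp.1, hp.2⟩
    · rintro ⟨a, b⟩ _ ⟨c, d⟩ _ h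
      simpa using h
    · rintro ⟨a, b⟩ hp
      simp only [Finset.mem_filter, Finset.mem_univ, true_and] at hp
      obtain ⟨ha, hb, hlt, hadj⟩ := hp
      rw [← Finset.mem_coe, ← he] at ha hb
      obtain ⟨i, rfl⟩ := ha
      obtain ⟨j, rfl⟩ := hb
      refine ⟨(i, j), ?_, rfl⟩
      simp only [Finset.mem_filter, Finset.mem_univ, true_and]
      exact ⟨e.lt_iff_lt.mp hlt, hadj⟩
  rw [h]
  have hs : ∀ i j, sgn G (e i) (e j) = 2 * (if G.Adj (e i) (e j) then 1 else 0) - 1 := by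
    intro i j; unfold sgn; split_ifs <;> norm_num
  simp only [ssum, hs, Fin.sum_univ_four]
  have h2 : ∀ i j, (if G.Adj (e i) (e j) then (2 : ℤ) else 0)
      = 2 * (if G.Adj (e i) (e j) then 1 else 0) := by
    intro i j; split_ifs <;> norm_num
  simp
  simp only [h2]
  ring

theorem count_le [NeZero n] :
    24 * (24 * (numKL 4 3 G : ℤ) + numKL 4 1 G + numKL 4 5 G) ≤ 12 * (n : ℤ) ^ 4 := by
  have h := quad_sum_le (sgn G) (sgn_cases G) (sgn_symm G)
  simp only [quad_eq, Fintype.card_fin] at h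
  let P := {S : Finset (Fin n) // S ∈ Finset.powersetCard 4 (Finset.univ : Finset (Fin n))}
  have hP : ∀ S : P, S.1.card = 4 := fun S => (Finset.mem_powersetCard.mp S.2).2
  let e : (S : P) → (Fin 4 ↪o Fin n) := fun S => S.1.orderEmbOfFin (hP S)
  have he : ∀ S : P, Set.range (e S) = S.1 := fun S => Finset.range_orderEmbOfFin S.1 (hP S)
  let φ : P × Equiv.Perm (Fin 4) → (Fin 4 → Fin n) := fun p i => e p.1 (p.2 i)
  have hφ : Function.Injective φ := by
    rintro ⟨S, π⟩ ⟨T, ρ⟩ hh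
    have hr : ∀ (S : P) (π : Equiv.Perm (Fin 4)), Set.range (φ (S, π)) = S.1 := by
      intro S π
      rw [← he S]
      exact π.surjective.range_comp (e S)
    have hST : S = T := by
      apply Subtype.ext
      apply Finset.coe_injective
      rw [← hr S π, ← hr T ρ, hh]
    subst hST
    have : π = ρ := by
      ext i
      have := congrFun hh i
      exact congrArg Fin.val ((e S).injective this)
    rw [this]
  have h1 : ∑ p : P × Equiv.Perm (Fin 4), wt (ssum G (φ p)) ≤ ∑ v, wt (ssum G v) := by
    refine le_of_eq_of_le (Finset.sum_map Finset.univ (⟨φ, hφ⟩ : _ ↪ _)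
      (fun v => wt (ssum G v))).symm ?_
    exact Finset.sum_le_sum_of_subset_of_nonneg (Finset.subset_univ _)
      fun v _ _ => wt_nonneg G v
  have h2 : ∑ p : P × Equiv.Perm (Fin 4), wt (ssum G (φ p))
      = 24 * ∑ S : P, wt (2 * (edgeCount G S.1 : ℤ) - 6) := by
    rw [Fintype.sum_prod_type, Finset.mul_sum]
    refine Finset.sum_congr rfl fun S _ => ?_
    have : ∀ π : Equiv.Perm (Fin 4), wt (ssum G (φ (S, π))) = wt (2 * (edgeCount G S.1 : ℤ) - 6) := by
      intro π
      rw [← edgeCount_eq G (e S) S.1 (he S)]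
      exact congrArg wt (ssum_perm G (e S) π)
    simp only [this, Finset.sum_const, Finset.card_univ, Fintype.card_perm, Fintype.card_fin]
    simp [Nat.factorial]
  have h3 : ∑ S : P, wt (2 * (edgeCount G S.1 : ℤ) - 6)
      = 288000 * (24 * (numKL 4 3 G : ℤ) + numKL 4 1 G + numKL 4 5 G) := by
    have hv : ∀ S : P, wt (2 * (edgeCount G S.1 : ℤ) - 6)
        = 288000 * (24 * (if edgeCount G S.1 = 3 then 1 else 0)
          + (if edgeCount G S.1 = 1 then 1 else 0) + (if edgeCount G S.1 = 5 then 1 else 0)) := by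
      intro S
      obtain ⟨k, hk, hk2⟩ := ssum_range G (e S)
      rw [edgeCount_eq G (e S) S.1 (he S)] at hk2
      have : edgeCount G S.1 = k := by omega
      rw [this]
      exact wt_val k hk
    have hc : ∀ l : ℕ, (numKL 4 l G : ℤ) = ∑ S : P, if edgeCount G S.1 = l then 1 else 0 := by
      intro l
      unfold numKL
      rw [Finset.card_filter]
      push_cast
      exact (Finset.sum_coe_sort (Finset.powersetCard 4 (Finset.univ : Finset (Fin n)))
        (fun S => if edgeCount G S = l then (1 : ℤ) else 0)).symm
    simp only [hv, hc, ← Finset.mul_sum, Finset.sum_add_distrib]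
  rw [h2, h3] at h1
  linarith

end Count

theorem lam43_almost_extremal_few_41_45 :
    ∀ ε : ℝ, 0 < ε → ∃ δ : ℝ, 0 < δ ∧ ∃ n₀ : ℕ, ∀ n : ℕ, n₀ ≤ n →
      ∀ G : SimpleGraph (Fin n), 1/2 - δ ≤ lamKL 4 3 G →
        lamKL 4 1 G ≤ ε ∧ lamKL 4 5 G ≤ ε := by
  intro ε hε
  obtain ⟨N, hN⟩ := exists_nat_gt (288 / ε)
  refine ⟨ε / 48, by positivity, max 12 N, fun n hn G h => ?_⟩
  have hn12 : 12 ≤ n := le_trans (le_max_left _ _) hn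
  have hnN : N ≤ n := le_trans (le_max_right _ _) hn
  have : NeZero n := ⟨by omega⟩
  have hc : (24 * (24 * (numKL 4 3 G : ℝ) + numKL 4 1 G + numKL 4 5 G)) ≤ 12 * (n : ℝ) ^ 4 := by
    exact_mod_cast count_le G
  have hx : (12 : ℝ) ≤ n := by exact_mod_cast hn12
  have hxe : 288 < n * ε := by
    have : 288 / ε < n := lt_of_lt_of_le hN (by exact_mod_cast hnN)
    rwa [div_lt_iff₀ hε] at this
  have hch : 24 * (n.choose 4 : ℝ) = n * (n - 1) * (n - 2) * (n - 3) := by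
    obtain ⟨m, rfl⟩ : ∃ m, n = m + 4 := ⟨n - 4, by omega⟩
    have h1 := Nat.descFactorial_eq_factorial_mul_choose (m + 4) 4
    have h2 : (m + 4).descFactorial 4 = (m + 1) * ((m + 2) * ((m + 3) * (m + 4))) := by
      simp [Nat.descFactorial_succ]
    rw [h2] at h1
    have h3 : ((m + 1) * ((m + 2) * ((m + 3) * (m + 4))) : ℝ) = 24 * ((m + 4).choose 4 : ℝ) := by
      exact_mod_cast h1
    rw [← h3]; push_cast; ring
  have hpos : (0 : ℝ) < n.choose 4 := by exact_mod_cast Nat.choose_pos (by omega)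
  -- the main numerical estimate
  have hbig : 12 * (n : ℝ) ^ 4 ≤ (12 + ε / 2) * (24 * (n.choose 4 : ℝ)) := by
    rw [hch]
    generalize (n : ℝ) = x at hx hxe
    have h1 : x ^ 4 - x * (x - 1) * (x - 2) * (x - 3) ≤ 6 * x ^ 3 := by nlinarith
    have h2 : x ^ 4 ≤ 2 * (x * (x - 1) * (x - 2) * (x - 3)) := by
      have : x ^ 3 * 12 ≤ x ^ 3 * x := by gcongr
      nlinarith
    have h3 : 288 * x ^ 3 ≤ ε * x ^ 4 := by
      have : 288 * x ^ 3 ≤ (x * ε) * x ^ 3 := by gcongr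
      linarith [this]
    have h4 : ε * x ^ 4 ≤ ε * (2 * (x * (x - 1) * (x - 2) * (x - 3))) := by gcongr
    linarith
  have key : 24 * lamKL 4 3 G + lamKL 4 1 G + lamKL 4 5 G ≤ 12 + ε / 2 := by
    unfold lamKL
    have : 24 * ((numKL 4 3 G : ℝ) / (n.choose 4 : ℝ)) + (numKL 4 1 G : ℝ) / (n.choose 4 : ℝ)
        + (numKL 4 5 G : ℝ) / (n.choose 4 : ℝ)
        = (24 * (numKL 4 3 G : ℝ) + numKL 4 1 G + numKL 4 5 G) / (n.choose 4 : ℝ) := by ring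
    rw [this, div_le_iff₀ hpos]
    linarith
  have p1 : 0 ≤ lamKL 4 1 G := by unfold lamKL; positivity
  have p5 : 0 ≤ lamKL 4 5 G := by unfold lamKL; positivity
  constructor <;> linarith
end
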